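/- arXiv:1210.7221 — 2 statements merged into one kernel-verified Lean document; each statement's English description precedes it below -/
import Mathlib

section
/- For each continuous function f : Δ(K)×Δ(L) → [−1,1], there exists a unique continuous w : Δ(K)×Δ(L) → [−1,1] satisfying the Mertens–Zamir system: w(p,q) = vex_II max(w,f)(p,q) and w(p,q) = cav_I min(w,f)(p,q) for all (p,q) ∈ Δ(K)×Δ(L). Moreover this solution equals pointwise both the supremum of the set C^-(f) and the infimum of the set C^+(f). -/
/-- `cavI f`, the concavification of `f` in its first variable over `Δ(K)`:
the supremum of `∑ α_m f(p_m, q)` over finite convex decompositions `p = ∑ α_m p_m`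
with `p_m ∈ Δ(K)`. -/
noncomputable def cavI {K L : Type*} [Fintype K] (f : (K → ℝ) → (L → ℝ) → ℝ)
    (p : K → ℝ) (q : L → ℝ) : ℝ :=
  sSup {x : ℝ | ∃ (n : ℕ) (α : Fin n → ℝ) (ps : Fin n → K → ℝ),
    (∀ m, 0 ≤ α m) ∧ (∑ m, α m = 1) ∧ (∀ m, ps m ∈ stdSimplex ℝ K) ∧
    (∑ m, α m • ps m = p) ∧ x = ∑ m, α m * f (ps m) q}

/-- `vexII f`, the convexification of `f` in its second variable over `Δ(L)`:
the infimum of `∑ α_m f(p, q_m)` over finite convex decompositions `q = ∑ α_m q_m`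
with `q_m ∈ Δ(L)`. -/
noncomputable def vexII {K L : Type*} [Fintype L] (f : (K → ℝ) → (L → ℝ) → ℝ)
    (p : K → ℝ) (q : L → ℝ) : ℝ :=
  sInf {x : ℝ | ∃ (n : ℕ) (α : Fin n → ℝ) (qs : Fin n → L → ℝ),
    (∀ m, 0 ≤ α m) ∧ (∑ m, α m = 1) ∧ (∀ m, qs m ∈ stdSimplex ℝ L) ∧
    (∑ m, α m • qs m = q) ∧ x = ∑ m, α m * f p (qs m)}

/-- Membership in `𝒞`: continuous on `Δ(K)×Δ(L)` with values in `[-1,1]` there. -/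
def MemC {K L : Type*} [Fintype K] [Fintype L] (f : (K → ℝ) → (L → ℝ) → ℝ) : Prop :=
  ContinuousOn (fun pq : (K → ℝ) × (L → ℝ) => f pq.1 pq.2)
    (stdSimplex ℝ K ×ˢ stdSimplex ℝ L) ∧
  ∀ p ∈ stdSimplex ℝ K, ∀ q ∈ stdSimplex ℝ L, f p q ∈ Set.Icc (-1 : ℝ) 1

/-- Membership in `𝒞⁺(f)`: `w ∈ 𝒞`, `w` is I-concave, and
`w(p,q) ≥ vex_II max(w,f)(p,q)` on `Δ(K)×Δ(L)`. -/
def memCplus {K L : Type*} [Fintype K] [Fintype L]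
    (f w : (K → ℝ) → (L → ℝ) → ℝ) : Prop :=
  MemC w ∧ (∀ q ∈ stdSimplex ℝ L, ConcaveOn ℝ (stdSimplex ℝ K) (fun p => w p q)) ∧
  ∀ p ∈ stdSimplex ℝ K, ∀ q ∈ stdSimplex ℝ L,
    vexII (fun p' q' => max (w p' q') (f p' q')) p q ≤ w p q

/-- Membership in `𝒞⁻(f)`: `w ∈ 𝒞`, `w` is II-convex, and
`w(p,q) ≤ cav_I min(w,f)(p,q)` on `Δ(K)×Δ(L)`. -/
def memCminus {K L : Type*} [Fintype K] [Fintype L]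
    (f w : (K → ℝ) → (L → ℝ) → ℝ) : Prop :=
  MemC w ∧ (∀ p ∈ stdSimplex ℝ K, ConvexOn ℝ (stdSimplex ℝ L) (fun q => w p q)) ∧
  ∀ p ∈ stdSimplex ℝ K, ∀ q ∈ stdSimplex ℝ L,
    w p q ≤ cavI (fun p' q' => min (w p' q') (f p' q')) p q

section cavI

variable {K L : Type*}

/-- Exchange the roles of the two players. -/
def negSwap (g : (K → ℝ) → (L → ℝ) → ℝ) : (L → ℝ) → (K → ℝ) → ℝ := fun q p => -g p q

lemma vexII_eq_neg_cavI [Fintype L] (g : (K → ℝ) → (L → ℝ) → ℝ)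
    (p : K → ℝ) (q : L → ℝ) : vexII g p q = -cavI (negSwap g) q p := by
  unfold vexII cavI
  rw [Real.sInf_def]
  congr 2
  ext x
  simp only [Set.mem_neg, Set.mem_ofPred_eq, negSwap, mul_neg, Finset.sum_neg_distrib,
    neg_eq_iff_eq_neg]

variable [Fintype K]

lemma le_cavI_of_split {g : (K → ℝ) → (L → ℝ) → ℝ} {q : L → ℝ} {M : ℝ}
    (hg : ∀ p ∈ stdSimplex ℝ K, g p q ≤ M) {ι : Type*} [Fintype ι] {α : ι → ℝ}
    {ps : ι → K → ℝ} (h0 : ∀ m, 0 ≤ α m) (h1 : ∑ m, α m = 1)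
    (hps : ∀ m, ps m ∈ stdSimplex ℝ K) :
    ∑ m, α m * g (ps m) q ≤ cavI g (∑ m, α m • ps m) q := by
  apply le_csSup
  · refine ⟨M, ?_⟩
    rintro x ⟨n, β, qs, hβ, hβ1, hqs, -, rfl⟩
    calc ∑ m, β m * g (qs m) q ≤ ∑ m, β m * M :=
          Finset.sum_le_sum fun m _ => mul_le_mul_of_nonneg_left (hg _ (hqs m)) (hβ m)
      _ = M := by rw [← Finset.sum_mul, hβ1, one_mul]
  · let e := (Fintype.equivFin ι).symm
    refine ⟨Fintype.card ι, α ∘ e, ps ∘ e, fun m => h0 _, ?_, fun m => hps _, ?_, ?_⟩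
    · rw [← h1]; exact e.sum_comp α
    · exact e.sum_comp (fun m => α m • ps m)
    · exact (e.sum_comp (fun m => α m * g (ps m) q)).symm

lemma le_cavI {g : (K → ℝ) → (L → ℝ) → ℝ} {q : L → ℝ} {M : ℝ}
    (hg : ∀ p ∈ stdSimplex ℝ K, g p q ≤ M) {p : K → ℝ} (hp : p ∈ stdSimplex ℝ K) :
    g p q ≤ cavI g p q := by
  have := le_cavI_of_split hg (ι := Unit) (α := fun _ => 1) (ps := fun _ => p)
    (by simp) (by simp) (by simpa using hp)
  simpa using this

lemma cavI_le {g : (K → ℝ) → (L → ℝ) → ℝ} {q : L → ℝ} {ψ : (K → ℝ) → ℝ}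
    (hψ : ConcaveOn ℝ (stdSimplex ℝ K) ψ) (hg : ∀ p ∈ stdSimplex ℝ K, g p q ≤ ψ p)
    {p : K → ℝ} (hp : p ∈ stdSimplex ℝ K) : cavI g p q ≤ ψ p := by
  apply csSup_le
  · exact ⟨_, 1, fun _ => 1, fun _ => p, by simp, by simp, by simpa using hp, by simp, rfl⟩
  · rintro x ⟨n, α, ps, h0, h1, hps, rfl, rfl⟩
    calc ∑ m, α m * g (ps m) q ≤ ∑ m, α m * ψ (ps m) :=
          Finset.sum_le_sum fun m _ => mul_le_mul_of_nonneg_left (hg _ (hps m)) (h0 m)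
      _ ≤ ψ (∑ m, α m • ps m) := by
          simpa using hψ.le_map_sum (fun m _ => h0 m) h1 (fun m _ => hps m)

lemma exists_split_lt {g : (K → ℝ) → (L → ℝ) → ℝ} {q : L → ℝ} {p : K → ℝ}
    (hp : p ∈ stdSimplex ℝ K) {y : ℝ} (hy : y < cavI g p q) :
    ∃ (n : ℕ) (α : Fin n → ℝ) (ps : Fin n → K → ℝ), (∀ m, 0 ≤ α m) ∧ (∑ m, α m = 1) ∧
      (∀ m, ps m ∈ stdSimplex ℝ K) ∧ (∑ m, α m • ps m = p) ∧ y < ∑ m, α m * g (ps m) q := by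
  obtain ⟨x, ⟨n, α, ps, h0, h1, hps, h, rfl⟩, hx⟩ := exists_lt_of_lt_csSup
    (by exact ⟨_, 1, fun _ => 1, fun _ => p, by simp, by simp, by simpa using hp, by simp, rfl⟩)
    hy
  exact ⟨n, α, ps, h0, h1, hps, h, hx⟩

lemma concaveOn_cavI {g : (K → ℝ) → (L → ℝ) → ℝ} {q : L → ℝ} {M : ℝ}
    (hg : ∀ p ∈ stdSimplex ℝ K, g p q ≤ M) :
    ConcaveOn ℝ (stdSimplex ℝ K) (fun p => cavI g p q) := by
  refine ⟨convex_stdSimplex ℝ K, ?_⟩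
  intro p hp p' hp' a b ha hb hab
  simp only [smul_eq_mul]
  refine le_of_forall_pos_le_add fun ε hε => ?_
  obtain ⟨n, α, ps, h0, h1, hps, h, hx⟩ :=
    exists_split_lt (g := g) (q := q) hp (sub_lt_self _ hε)
  obtain ⟨n', α', ps', h0', h1', hps', h', hx'⟩ :=
    exists_split_lt (g := g) (q := q) hp' (sub_lt_self _ hε)
  have key := le_cavI_of_split hg (ι := Fin n ⊕ Fin n')
    (α := Sum.elim (fun m => a * α m) (fun m => b * α' m)) (ps := Sum.elim ps ps')
    (by rintro (m | m)
        · exact mul_nonneg ha (h0 m)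
        · exact mul_nonneg hb (h0' m))
    (by simp [← Finset.mul_sum, h1, h1', hab])
    (by rintro (m | m)
        · exact hps m
        · exact hps' m)
  simp only [Fintype.sum_sum_type, Sum.elim_inl, Sum.elim_inr, mul_assoc, mul_smul,
    ← Finset.mul_sum, ← Finset.smul_sum, h, h'] at key
  have h2 := mul_le_mul_of_nonneg_left hx.le ha
  have h3 := mul_le_mul_of_nonneg_left hx'.le hb
  have h4 : a * ε + b * ε = ε := by rw [← add_mul, hab, one_mul]
  linarith

lemma exists_transport {p p' : K → ℝ} (hp : p ∈ stdSimplex ℝ K) (hp' : p' ∈ stdSimplex ℝ K) :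
    ∃ (A : (K → ℝ) →ₗ[ℝ] (K → ℝ)) (c : (K → ℝ) →ₗ[ℝ] ℝ),
      (∀ x ∈ stdSimplex ℝ K, A x ∈ stdSimplex ℝ K) ∧ A p = p' ∧
      (∀ x ∈ stdSimplex ℝ K, ∑ k, |x k - A x k| ≤ c x) ∧ c p = ∑ k, |p k - p' k| := by
  by_cases hpp : p = p'
  · subst hpp
    exact ⟨LinearMap.id, 0, by simp, by simp, by simp, by simp⟩
  set d := ∑ k, (p' k - min (p k) (p' k)) with hd
  have hs0 : ∀ k, 0 ≤ p' k - min (p k) (p' k) := fun k => sub_nonneg.2 (min_le_right _ _)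
  have hdr : ∑ k, (p k - min (p k) (p' k)) = d := by
    rw [hd, Finset.sum_sub_distrib, Finset.sum_sub_distrib, hp.2, hp'.2]
  have habs : ∑ k, |p k - p' k| = 2 * d := by
    have : ∀ k, |p k - p' k| = (p k - min (p k) (p' k)) + (p' k - min (p k) (p' k)) := by
      intro k
      rcases le_total (p k) (p' k) with h | h
      · rw [min_eq_left h, abs_of_nonpos (by linarith)]; ring
      · rw [min_eq_right h, abs_of_nonneg (by linarith)]; ring
    simp only [this]
    rw [Finset.sum_add_distrib, hdr, ← hd]; ring
  have hd0 : 0 < d := by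
    refine (Finset.sum_nonneg fun k _ => hs0 k).lt_of_ne fun h => hpp ?_
    rw [← hd] at h
    rw [← h, mul_zero, Finset.sum_eq_zero_iff_of_nonneg (fun _ _ => abs_nonneg _)] at habs
    ext k
    exact sub_eq_zero.1 (abs_eq_zero.1 (habs k (Finset.mem_univ k)))
  set ρ : K → ℝ := fun k => min (p k) (p' k) / p k with hρ
  set σ : K → ℝ := fun k => (p' k - min (p k) (p' k)) / d with hσ
  have hρ0 : ∀ k, 0 ≤ ρ k := fun k => div_nonneg (le_min (hp.1 k) (hp'.1 k)) (hp.1 k)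
  have hρ1 : ∀ k, ρ k ≤ 1 := fun k => div_le_one_of_le₀ (min_le_left _ _) (hp.1 k)
  have hσ0 : ∀ k, 0 ≤ σ k := fun k => div_nonneg (hs0 k) hd0.le
  have hσ1 : ∑ k, σ k = 1 := by
    rw [hσ, ← Finset.sum_div, ← hd, div_self hd0.ne']
  have hρp : ∀ k, ρ k * p k = min (p k) (p' k) := by
    intro k
    by_cases h : p k = 0
    · rw [h, mul_zero, min_eq_left (hp'.1 k)]
    · exact div_mul_cancel₀ _ h
  let ℓ : (K → ℝ) →ₗ[ℝ] ℝ := ∑ j, (1 - ρ j) • LinearMap.proj j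
  have hℓ : ∀ x, ℓ x = ∑ j, (1 - ρ j) * x j := fun x => by simp [ℓ]
  let A : (K → ℝ) →ₗ[ℝ] (K → ℝ) :=
    LinearMap.pi fun k => ρ k • LinearMap.proj k + σ k • ℓ
  have hA : ∀ x k, A x k = ρ k * x k + σ k * ℓ x := fun x k => by simp [A]
  have hℓ0 : ∀ x ∈ stdSimplex ℝ K, 0 ≤ ℓ x := fun x hx => by
    rw [hℓ]
    exact Finset.sum_nonneg fun j _ => mul_nonneg (sub_nonneg.2 (hρ1 j)) (hx.1 j)
  have hℓp : ℓ p = d := by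
    rw [hℓ, ← hdr]
    exact Finset.sum_congr rfl fun k _ => by rw [sub_mul, one_mul, hρp]
  refine ⟨A, (2 : ℝ) • ℓ, ?_, ?_, ?_, ?_⟩
  · intro x hx
    refine ⟨fun k => ?_, ?_⟩
    · rw [hA]
      exact add_nonneg (mul_nonneg (hρ0 k) (hx.1 k)) (mul_nonneg (hσ0 k) (hℓ0 x hx))
    · simp only [hA]
      rw [Finset.sum_add_distrib, ← Finset.sum_mul, hσ1, hℓ, one_mul, ← Finset.sum_add_distrib]
      refine Eq.trans ?_ hx.2
      exact Finset.sum_congr rfl fun k _ => by ring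
  · ext k
    rw [hA, hρp, hℓp, hσ, div_mul_cancel₀ _ hd0.ne']; ring
  · intro x hx
    calc ∑ k, |x k - A x k| ≤ ∑ k, ((1 - ρ k) * x k + σ k * ℓ x) := by
          refine Finset.sum_le_sum fun k _ => ?_
          have h1 := mul_nonneg (sub_nonneg.2 (hρ1 k)) (hx.1 k)
          have h2 := mul_nonneg (hσ0 k) (hℓ0 x hx)
          rw [hA, abs_le]
          constructor <;> linarith
      _ = ((2 : ℝ) • ℓ) x := by
          rw [Finset.sum_add_distrib, ← Finset.sum_mul, hσ1, ← hℓ]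
          simp; ring
  · rw [habs, ← hℓp]; simp

variable [Fintype L]

/-- Values in `[-1,1]` on `Δ(K)×Δ(L)`. -/
def UnitBounded (g : (K → ℝ) → (L → ℝ) → ℝ) : Prop :=
  ∀ p ∈ stdSimplex ℝ K, ∀ q ∈ stdSimplex ℝ L, g p q ∈ Set.Icc (-1 : ℝ) 1

/-- `g` has, up to every additive error `δ > 0`, Lipschitz constant `C δ` for the `L¹` norm. -/
def NearLip (C : ℝ → ℝ) (g : (K → ℝ) → (L → ℝ) → ℝ) : Prop :=
  ∀ δ > 0, ∀ p ∈ stdSimplex ℝ K, ∀ p' ∈ stdSimplex ℝ K, ∀ q ∈ stdSimplex ℝ L,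
    ∀ q' ∈ stdSimplex ℝ L,
    g p q - g p' q' ≤ δ + C δ * (∑ k, |p k - p' k| + ∑ l, |q l - q' l|)

lemma UnitBounded.negSwap {g : (K → ℝ) → (L → ℝ) → ℝ} (h : UnitBounded g) :
    UnitBounded (negSwap g) := by
  intro q hq p hp
  have := h p hp q hq
  simp only [_root_.negSwap, Set.mem_Icc] at *
  constructor <;> linarith

lemma NearLip.negSwap {C : ℝ → ℝ} {g : (K → ℝ) → (L → ℝ) → ℝ} (h : NearLip C g) :
    NearLip C (negSwap g) := by
  intro δ hδ q hq q' hq' p hp p' hp'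
  have := h δ hδ p' hp' p hp q' hq' q hq
  simp only [_root_.negSwap, abs_sub_comm (q _), abs_sub_comm (p _)]
  rw [add_comm (∑ k, _)]
  linarith

lemma UnitBounded.le_one {g : (K → ℝ) → (L → ℝ) → ℝ} (hg : UnitBounded g) {q : L → ℝ}
    (hq : q ∈ stdSimplex ℝ L) : ∀ p ∈ stdSimplex ℝ K, g p q ≤ 1 := fun p hp => (hg p hp q hq).2

lemma UnitBounded.cavI {g : (K → ℝ) → (L → ℝ) → ℝ} (hg : UnitBounded g) :
    UnitBounded (cavI g) := fun _ hp _ hq =>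
  ⟨(hg _ hp _ hq).1.trans (le_cavI (hg.le_one hq) hp),
    cavI_le (concaveOn_const 1 (convex_stdSimplex ℝ K)) (hg.le_one hq) hp⟩

lemma NearLip.cavI {C : ℝ → ℝ} (hC : ∀ δ, 0 ≤ C δ) {g : (K → ℝ) → (L → ℝ) → ℝ}
    (hb : UnitBounded g) (hg : NearLip C g) : NearLip C (cavI g) := by
  intro δ hδ p hp p' hp' q hq q' hq'
  obtain ⟨A, c, hA, hAp, hAc, hcp⟩ := exists_transport hp hp'
  have h1 : ConcaveOn ℝ (stdSimplex ℝ K) (fun x => _root_.cavI g (A x) q') :=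
    ((concaveOn_cavI (hb.le_one hq')).comp_linearMap A).subset hA (convex_stdSimplex ℝ K)
  have h2 : ConcaveOn ℝ (stdSimplex ℝ K) (fun x => (C δ • c) x) :=
    (C δ • c).concaveOn (convex_stdSimplex ℝ K)
  have h3 := (h1.add h2).add_const (δ + C δ * ∑ l, |q l - q' l|)
  have := cavI_le (g := g) (q := q) h3 (fun x hx => ?_) hp
  · simp only [Pi.add_apply, hAp, LinearMap.smul_apply, hcp, smul_eq_mul] at this
    linarith
  · have h4 := hg δ hδ x hx (A x) (hA x hx) q hq q' hq'
    have h5 := le_cavI (hb.le_one hq') (hA x hx)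
    have h6 := mul_le_mul_of_nonneg_left (hAc x hx) (hC δ)
    simp only [Pi.add_apply, LinearMap.smul_apply, smul_eq_mul]
    linarith

lemma convexOn_cavI {g : (K → ℝ) → (L → ℝ) → ℝ} (hb : UnitBounded g)
    (hg : ∀ p ∈ stdSimplex ℝ K, ConvexOn ℝ (stdSimplex ℝ L) (g p)) {p : K → ℝ}
    (hp : p ∈ stdSimplex ℝ K) : ConvexOn ℝ (stdSimplex ℝ L) (cavI g p) := by
  refine ⟨convex_stdSimplex ℝ L, ?_⟩
  intro q hq q' hq' a b ha hb' hab
  refine cavI_le (((concaveOn_cavI (hb.le_one hq)).smul ha).add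
    ((concaveOn_cavI (hb.le_one hq')).smul hb')) (fun x hx => ?_) hp
  refine ((hg x hx).2 hq hq' ha hb' hab).trans ?_
  exact add_le_add (mul_le_mul_of_nonneg_left (le_cavI (hb.le_one hq) hx) ha)
    (mul_le_mul_of_nonneg_left (le_cavI (hb.le_one hq') hx) hb')

end cavI

section vexII

variable {K L : Type*}

lemma negSwap_max (g h : (K → ℝ) → (L → ℝ) → ℝ) :
    negSwap (fun p q => max (g p q) (h p q)) =
      fun q p => min (negSwap g q p) (negSwap h q p) := by
  funext q p
  exact neg_sup _ _

variable [Fintype L]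

lemma vexII_eq_negSwap (g : (K → ℝ) → (L → ℝ) → ℝ) :
    vexII g = negSwap (cavI (negSwap g)) := by
  funext p q
  exact vexII_eq_neg_cavI g p q

lemma le_vexII {g : (K → ℝ) → (L → ℝ) → ℝ} {p : K → ℝ} {ψ : (L → ℝ) → ℝ}
    (hψ : ConvexOn ℝ (stdSimplex ℝ L) ψ) (hg : ∀ q ∈ stdSimplex ℝ L, ψ q ≤ g p q)
    {q : L → ℝ} (hq : q ∈ stdSimplex ℝ L) : ψ q ≤ vexII g p q := by
  rw [vexII_eq_neg_cavI, le_neg]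
  exact cavI_le hψ.neg (fun x hx => neg_le_neg (hg x hx)) hq

variable [Fintype K]

lemma UnitBounded.vexII {g : (K → ℝ) → (L → ℝ) → ℝ} (hg : UnitBounded g) :
    UnitBounded (vexII g) := by
  rw [vexII_eq_negSwap]
  exact hg.negSwap.cavI.negSwap

lemma NearLip.vexII {C : ℝ → ℝ} (hC : ∀ δ, 0 ≤ C δ) {g : (K → ℝ) → (L → ℝ) → ℝ}
    (hb : UnitBounded g) (hg : NearLip C g) : NearLip C (vexII g) := by
  rw [vexII_eq_negSwap]
  exact (hg.negSwap.cavI hC hb.negSwap).negSwap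

lemma vexII_le {g : (K → ℝ) → (L → ℝ) → ℝ} (hb : UnitBounded g) {p : K → ℝ}
    (hp : p ∈ stdSimplex ℝ K) {q : L → ℝ} (hq : q ∈ stdSimplex ℝ L) :
    vexII g p q ≤ g p q := by
  rw [vexII_eq_neg_cavI, neg_le]
  exact le_cavI (hb.negSwap.le_one hp) hq

lemma convexOn_vexII {g : (K → ℝ) → (L → ℝ) → ℝ} (hb : UnitBounded g) {p : K → ℝ}
    (hp : p ∈ stdSimplex ℝ K) : ConvexOn ℝ (stdSimplex ℝ L) (vexII g p) := by
  rw [vexII_eq_negSwap]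
  exact (concaveOn_cavI (hb.negSwap.le_one hp)).neg

lemma concaveOn_vexII {g : (K → ℝ) → (L → ℝ) → ℝ} (hb : UnitBounded g)
    (hg : ∀ q ∈ stdSimplex ℝ L, ConcaveOn ℝ (stdSimplex ℝ K) (fun p => g p q)) {q : L → ℝ}
    (hq : q ∈ stdSimplex ℝ L) : ConcaveOn ℝ (stdSimplex ℝ K) (fun p => vexII g p q) := by
  rw [vexII_eq_negSwap]
  exact (convexOn_cavI hb.negSwap (fun q hq => (hg q hq).neg) hq).neg

lemma vexII_mono {g h : (K → ℝ) → (L → ℝ) → ℝ} (hb : UnitBounded g) {p : K → ℝ}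
    (hp : p ∈ stdSimplex ℝ K) (hgh : ∀ q ∈ stdSimplex ℝ L, g p q ≤ h p q) {q : L → ℝ}
    (hq : q ∈ stdSimplex ℝ L) : vexII g p q ≤ vexII h p q :=
  le_vexII (convexOn_vexII hb hp) (fun x hx => (vexII_le hb hp hx).trans (hgh x hx)) hq

end vexII

section regularity

variable {K L : Type*} [Fintype K] [Fintype L]

lemma UnitBounded.max {g h : (K → ℝ) → (L → ℝ) → ℝ} (hg : UnitBounded g)
    (hh : UnitBounded h) : UnitBounded (fun p q => max (g p q) (h p q)) := fun p hp q hq =>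
  ⟨(hg p hp q hq).1.trans (le_max_left _ _), max_le (hg p hp q hq).2 (hh p hp q hq).2⟩

lemma UnitBounded.min {g h : (K → ℝ) → (L → ℝ) → ℝ} (hg : UnitBounded g)
    (hh : UnitBounded h) : UnitBounded (fun p q => min (g p q) (h p q)) := fun p hp q hq =>
  ⟨le_min (hg p hp q hq).1 (hh p hp q hq).1, (min_le_left _ _).trans (hg p hp q hq).2⟩

lemma NearLip.max {C : ℝ → ℝ} {g h : (K → ℝ) → (L → ℝ) → ℝ} (hg : NearLip C g)
    (hh : NearLip C h) : NearLip C (fun p q => max (g p q) (h p q)) := by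
  intro δ hδ p hp p' hp' q hq q' hq'
  have h1 := hg δ hδ p hp p' hp' q hq q' hq'
  have h2 := hh δ hδ p hp p' hp' q hq q' hq'
  rw [sub_le_iff_le_add]
  refine max_le ?_ ?_
  · have := le_max_left (g p' q') (h p' q')
    linarith
  · have := le_max_right (g p' q') (h p' q')
    linarith

lemma NearLip.min {C : ℝ → ℝ} {g h : (K → ℝ) → (L → ℝ) → ℝ} (hg : NearLip C g)
    (hh : NearLip C h) : NearLip C (fun p q => min (g p q) (h p q)) := by
  intro δ hδ p hp p' hp' q hq q' hq'
  have h1 := hg δ hδ p hp p' hp' q hq q' hq'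
  have h2 := hh δ hδ p hp p' hp' q hq q' hq'
  rw [sub_le_comm]
  refine le_min ?_ ?_
  · have := min_le_left (g p q) (h p q)
    linarith
  · have := min_le_right (g p q) (h p q)
    linarith

lemma NearLip.continuousOn {C : ℝ → ℝ} {g : (K → ℝ) → (L → ℝ) → ℝ} (hg : NearLip C g) :
    ContinuousOn (fun pq : (K → ℝ) × (L → ℝ) => g pq.1 pq.2)
      (stdSimplex ℝ K ×ˢ stdSimplex ℝ L) := by
  rintro ⟨p, q⟩ ⟨hp, hq⟩
  rw [ContinuousWithinAt, Metric.tendsto_nhds]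
  intro ε hε
  have hc : Continuous fun x : (K → ℝ) × (L → ℝ) =>
      C (ε / 2) * (∑ k, |x.1 k - p k| + ∑ l, |x.2 l - q l|) := by fun_prop
  have hlt := hc.continuousAt.eventually_lt (continuousAt_const (y := ε / 2))
    (x₀ := (p, q)) (by simpa using hε)
  filter_upwards [mem_nhdsWithin_of_mem_nhds hlt, self_mem_nhdsWithin]
  rintro ⟨p', q'⟩ hx ⟨hp', hq'⟩
  have h1 := hg (ε / 2) (half_pos hε) p' hp' p hp q' hq' q hq
  have h2 := hg (ε / 2) (half_pos hε) p hp p' hp' q hq q' hq'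
  simp only [abs_sub_comm (p _), abs_sub_comm (q _)] at h2
  simp only at hx
  rw [Real.dist_eq, abs_lt]
  constructor <;> linarith

lemma MemC.exists_nearLip {f : (K → ℝ) → (L → ℝ) → ℝ} (hf : MemC f) :
    ∃ C : ℝ → ℝ, (∀ δ, 0 ≤ C δ) ∧ NearLip C f := by
  have huc := ((isCompact_stdSimplex ℝ K).prod
    (isCompact_stdSimplex ℝ L)).uniformContinuousOn_of_continuous hf.1
  rw [Metric.uniformContinuousOn_iff] at huc
  have : ∀ δ : ℝ, ∃ c : ℝ, 0 ≤ c ∧ (0 < δ → ∀ p ∈ stdSimplex ℝ K, ∀ p' ∈ stdSimplex ℝ K,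
      ∀ q ∈ stdSimplex ℝ L, ∀ q' ∈ stdSimplex ℝ L,
      f p q - f p' q' ≤ δ + c * (∑ k, |p k - p' k| + ∑ l, |q l - q' l|)) := by
    intro δ
    by_cases hδ : 0 < δ
    swap
    · exact ⟨0, le_rfl, fun h => absurd h hδ⟩
    obtain ⟨r, hr, h⟩ := huc δ hδ
    refine ⟨2 / r, by positivity, fun _ p hp p' hp' q hq q' hq' => ?_⟩
    have hs0 : 0 ≤ ∑ k, |p k - p' k| := Finset.sum_nonneg fun _ _ => abs_nonneg _
    have hs1 : 0 ≤ ∑ l, |q l - q' l| := Finset.sum_nonneg fun _ _ => abs_nonneg _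
    by_cases hd : ∑ k, |p k - p' k| + ∑ l, |q l - q' l| < r
    · have hdist : dist (p, q) (p', q') < r := by
        rw [Prod.dist_eq]
        refine max_lt ((dist_pi_lt_iff hr).2 fun k => ?_) ((dist_pi_lt_iff hr).2 fun l => ?_)
        · have := Finset.single_le_sum (f := fun k => |p k - p' k|)
            (fun _ _ => abs_nonneg _) (Finset.mem_univ k)
          rw [Real.dist_eq]
          linarith
        · have := Finset.single_le_sum (f := fun l => |q l - q' l|)
            (fun _ _ => abs_nonneg _) (Finset.mem_univ l)
          rw [Real.dist_eq]
          linarith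
      have h1 := h (p, q) ⟨hp, hq⟩ (p', q') ⟨hp', hq'⟩ hdist
      rw [Real.dist_eq] at h1
      have h2 := (le_abs_self _).trans h1.le
      have : 0 ≤ 2 / r * (∑ k, |p k - p' k| + ∑ l, |q l - q' l|) := by positivity
      linarith
    · have h1 := hf.2 p hp q hq
      have h2 := hf.2 p' hp' q' hq'
      have h3 : 2 / r * r ≤ 2 / r * (∑ k, |p k - p' k| + ∑ l, |q l - q' l|) :=
        mul_le_mul_of_nonneg_left (not_lt.1 hd) (by positivity)
      rw [div_mul_cancel₀ _ hr.ne'] at h3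
      linarith [h1.2, h2.1]
  choose C hC0 hC using this
  exact ⟨C, hC0, fun δ hδ => hC δ hδ⟩

lemma MemC.continuousOn_left {f : (K → ℝ) → (L → ℝ) → ℝ} (hf : MemC f) {q : L → ℝ}
    (hq : q ∈ stdSimplex ℝ L) : ContinuousOn (fun p => f p q) (stdSimplex ℝ K) :=
  hf.1.comp (f := fun p => (p, q)) (by fun_prop) fun _ hp => ⟨hp, hq⟩

lemma MemC.negSwap {f : (K → ℝ) → (L → ℝ) → ℝ} (hf : MemC f) : MemC (negSwap f) :=
  ⟨(hf.1.comp (f := Prod.swap) (by fun_prop) fun _ h => ⟨h.2, h.1⟩).neg,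
    UnitBounded.negSwap hf.2⟩

end regularity

section touching

variable {K L : Type*} [Fintype K]

lemma dist_lt_of_sum_sq_lt {x p : K → ℝ} {r : ℝ} (hr : 0 < r)
    (h : ∑ k, (x k - p k) ^ 2 < r ^ 2) : dist x p < r := by
  refine (dist_pi_lt_iff hr).2 fun k => ?_
  have := Finset.single_le_sum (f := fun k => (x k - p k) ^ 2)
    (fun _ _ => sq_nonneg _) (Finset.mem_univ k)
  rw [Real.dist_eq]
  exact abs_lt_of_sq_lt_sq (this.trans_lt h) hr.le

lemma sum_sq_le_one {p : K → ℝ} (hp : p ∈ stdSimplex ℝ K) : ∑ k, p k ^ 2 ≤ 1 := by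
  rw [← hp.2]
  refine Finset.sum_le_sum fun k _ => ?_
  have h1 : p k ≤ 1 := by
    rw [← hp.2]
    exact Finset.single_le_sum (fun k _ => hp.1 k) (Finset.mem_univ k)
  nlinarith [hp.1 k]

/-- At a maximizer of `u - h + ε‖·‖²` with `h` concave, `u` is strictly touched from above
by a concave function. -/
lemma exists_touching {u h : (K → ℝ) → ℝ} {ε : ℝ} {p : K → ℝ}
    (hh : ConcaveOn ℝ (stdSimplex ℝ K) h) (hc : ContinuousOn h (stdSimplex ℝ K))
    (hmax : ∀ x ∈ stdSimplex ℝ K,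
      u x - h x + ε * ∑ k, x k ^ 2 ≤ u p - h p + ε * ∑ k, p k ^ 2) :
    ∃ ψ : (K → ℝ) → ℝ, ConcaveOn ℝ (stdSimplex ℝ K) ψ ∧ ContinuousOn ψ (stdSimplex ℝ K) ∧
      ψ p = u p ∧ ∀ x ∈ stdSimplex ℝ K, u x + ε * ∑ k, (x k - p k) ^ 2 ≤ ψ x := by
  let ℓ : (K → ℝ) →ₗ[ℝ] ℝ := ∑ k, (-2 * ε * p k) • LinearMap.proj k
  have hℓ : ∀ x, ℓ x = -2 * ε * ∑ k, p k * x k := fun x => by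
    simp [ℓ, Finset.mul_sum, mul_assoc]
  have hℓc : Continuous ℓ := ℓ.continuous_of_finiteDimensional
  refine ⟨fun x => h x + ℓ x + (u p - h p - ℓ p),
    (hh.add (ℓ.concaveOn (convex_stdSimplex ℝ K))).add_const _,
    (hc.add hℓc.continuousOn).add continuousOn_const, by ring, fun x hx => ?_⟩
  have h1 := hmax x hx
  have h2 : ∑ k, (x k - p k) ^ 2 =
      ∑ k, x k ^ 2 - 2 * (∑ k, p k * x k) + ∑ k, p k * p k := by
    rw [Finset.mul_sum, ← Finset.sum_sub_distrib, ← Finset.sum_add_distrib]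
    exact Finset.sum_congr rfl fun k _ => by ring
  have h3 : ∑ k, p k ^ 2 = ∑ k, p k * p k := Finset.sum_congr rfl fun k _ => by ring
  simp only [hℓ]
  rw [h2]
  rw [h3] at h1
  linarith

lemma le_of_touching {u f : (K → ℝ) → (L → ℝ) → ℝ} {q : L → ℝ} {ψ : (K → ℝ) → ℝ}
    {p : K → ℝ} {ε : ℝ} (hε : 0 < ε) (hp : p ∈ stdSimplex ℝ K)
    (hψ : ConcaveOn ℝ (stdSimplex ℝ K) ψ) (hψc : ContinuousOn ψ (stdSimplex ℝ K))
    (hf : ContinuousOn (fun x => f x q) (stdSimplex ℝ K)) (hψp : ψ p = u p q)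
    (hu : ∀ x ∈ stdSimplex ℝ K, u x q + ε * ∑ k, (x k - p k) ^ 2 ≤ ψ x)
    (hcav : u p q ≤ cavI (fun x y => min (u x y) (f x y)) p q) : u p q ≤ f p q := by
  by_contra! hlt
  set e := (u p q - f p q) / 2 with he
  have he0 : 0 < e := by linarith
  have hev : ∀ᶠ x in nhdsWithin p (stdSimplex ℝ K), e < ψ x - f x q :=
    ((hψc p hp).sub (hf p hp)).eventually_const_lt (by
      show e < ψ p - f p q
      linarith)
  obtain ⟨r, hr, hball⟩ := Metric.mem_nhdsWithin_iff.1 hev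
  have hη : 0 < min e (ε * r ^ 2) := lt_min he0 (by positivity)
  have key := cavI_le (g := fun x y => min (u x y) (f x y)) (q := q)
    (hψ.add_const (-min e (ε * r ^ 2))) (fun x hx => ?_) hp
  · simp only [Pi.add_apply] at key
    linarith
  · have h1 := min_le_left e (ε * r ^ 2)
    have h2 := min_le_right e (ε * r ^ 2)
    by_cases hd : ∑ k, (x k - p k) ^ 2 < r ^ 2
    · have : e < ψ x - f x q := hball ⟨dist_lt_of_sum_sq_lt hr hd, hx⟩
      refine (min_le_right _ _).trans ?_
      simp only [Pi.add_apply]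
      linarith
    · have h3 := mul_le_mul_of_nonneg_left (not_lt.1 hd) hε.le
      have h4 := hu x hx
      refine (min_le_left _ _).trans ?_
      simp only [Pi.add_apply]
      linarith

variable [Fintype L]

lemma le_of_isMax {u v f : (K → ℝ) → (L → ℝ) → ℝ} (hf : MemC f) (hv : MemC v) {q : L → ℝ}
    (hq : q ∈ stdSimplex ℝ L) (hvc : ConcaveOn ℝ (stdSimplex ℝ K) (fun p => v p q))
    {p : K → ℝ} (hp : p ∈ stdSimplex ℝ K) {ε : ℝ} (hε : 0 < ε)
    (hmax : ∀ x ∈ stdSimplex ℝ K,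
      u x q - v x q + ε * ∑ k, x k ^ 2 ≤ u p q - v p q + ε * ∑ k, p k ^ 2)
    (hcav : u p q ≤ cavI (fun x y => min (u x y) (f x y)) p q) : u p q ≤ f p q := by
  obtain ⟨ψ, h1, h2, h3, h4⟩ := exists_touching (u := fun x => u x q) hvc
    (hv.continuousOn_left hq) hmax
  exact le_of_touching hε hp h1 h2 (hf.continuousOn_left hq) h3 h4 hcav

/-- Comparison principle. -/
lemma memCminus.le_memCplus {f u v : (K → ℝ) → (L → ℝ) → ℝ} (hf : MemC f)
    (hu : memCminus f u) (hv : memCplus f v) {p : K → ℝ} (hp : p ∈ stdSimplex ℝ K)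
    {q : L → ℝ} (hq : q ∈ stdSimplex ℝ L) : u p q ≤ v p q := by
  refine le_of_forall_pos_le_add fun ε hε => ?_
  have hc : ContinuousOn (fun x : (K → ℝ) × (L → ℝ) => u x.1 x.2 - v x.1 x.2 +
      (ε / 2) * (∑ k, x.1 k ^ 2 + ∑ l, x.2 l ^ 2)) (stdSimplex ℝ K ×ˢ stdSimplex ℝ L) :=
    (hu.1.1.sub hv.1.1).add (Continuous.continuousOn (by fun_prop))
  obtain ⟨⟨p₁, q₁⟩, ⟨hp₁, hq₁⟩, hmax⟩ := ((isCompact_stdSimplex ℝ K).prod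
    (isCompact_stdSimplex ℝ L)).exists_isMaxOn ⟨(p, q), hp, hq⟩ hc
  have hmax' : ∀ x ∈ stdSimplex ℝ K, ∀ y ∈ stdSimplex ℝ L, _ := fun x hx y hy =>
    hmax (Set.mk_mem_prod hx hy)
  simp only [Set.mem_ofPred_eq] at hmax'
  have h1 : u p₁ q₁ ≤ f p₁ q₁ := by
    refine le_of_isMax hf hv.1 hq₁ (hv.2.1 q₁ hq₁) hp₁ (half_pos hε) (fun x hx => ?_)
      (hu.2.2 p₁ hp₁ q₁ hq₁)
    have := hmax' x hx q₁ hq₁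
    linarith
  have h2 : negSwap v q₁ p₁ ≤ negSwap f q₁ p₁ := by
    refine le_of_isMax hf.negSwap hu.1.negSwap hp₁ (hu.2.1 p₁ hp₁).neg hq₁ (half_pos hε)
      (fun y hy => ?_) ?_
    · have := hmax' p₁ hp₁ y hy
      simp only [negSwap]
      linarith
    · have := hv.2.2 p₁ hp₁ q₁ hq₁
      rw [vexII_eq_neg_cavI, negSwap_max] at this
      exact neg_le.1 this
  simp only [negSwap] at h2
  have h3 := hmax' p hp q hq
  have h4 := sum_sq_le_one hp₁
  have h5 := sum_sq_le_one hq₁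
  have h6 : 0 ≤ ∑ k, p k ^ 2 := Finset.sum_nonneg fun _ _ => sq_nonneg _
  have h7 : 0 ≤ ∑ l, q l ^ 2 := Finset.sum_nonneg fun _ _ => sq_nonneg _
  have h8 : ε / 2 * (∑ k, p₁ k ^ 2 + ∑ l, q₁ l ^ 2) ≤ ε / 2 * 2 :=
    mul_le_mul_of_nonneg_left (by linarith) (half_pos hε).le
  have h9 : 0 ≤ ε / 2 * (∑ k, p k ^ 2 + ∑ l, q l ^ 2) := by positivity
  linarith

/-- The smallest element of `𝒞⁺(f)` lies below `f` wherever it is strictly touched from above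
by a concave function of the first variable. -/
lemma le_of_touching_of_least {C : ℝ → ℝ} (hC : ∀ δ, 0 ≤ C δ)
    {f v : (K → ℝ) → (L → ℝ) → ℝ} (hf : MemC f) (hvC : NearLip C v) (hv : memCplus f v)
    (hleast : ∀ w, memCplus f w → ∀ p ∈ stdSimplex ℝ K, ∀ q ∈ stdSimplex ℝ L, v p q ≤ w p q)
    {ψ : (K → ℝ) → ℝ} {p₀ : K → ℝ} {q₀ : L → ℝ} {ε : ℝ} (hε : 0 < ε)
    (hp₀ : p₀ ∈ stdSimplex ℝ K) (hq₀ : q₀ ∈ stdSimplex ℝ L)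
    (hψ : ConcaveOn ℝ (stdSimplex ℝ K) ψ) (hψc : ContinuousOn ψ (stdSimplex ℝ K))
    (hψp : ψ p₀ = v p₀ q₀)
    (htouch : ∀ x ∈ stdSimplex ℝ K, v x q₀ + ε * ∑ k, (x k - p₀ k) ^ 2 ≤ ψ x) :
    v p₀ q₀ ≤ f p₀ q₀ := by
  by_contra! hlt
  set e := (v p₀ q₀ - f p₀ q₀) / 2 with he
  have he0 : 0 < e := by linarith
  have hψc' : ContinuousOn (fun x : (K → ℝ) × (L → ℝ) => ψ x.1)
      (stdSimplex ℝ K ×ˢ stdSimplex ℝ L) := hψc.comp continuousOn_fst fun _ h => h.1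
  have hev : ∀ᶠ x in nhdsWithin (p₀, q₀) (stdSimplex ℝ K ×ˢ stdSimplex ℝ L),
      e < ψ x.1 - f x.1 x.2 :=
    ((hψc' _ ⟨hp₀, hq₀⟩).sub (hf.1 _ ⟨hp₀, hq₀⟩)).eventually_const_lt (by
      show e < ψ p₀ - f p₀ q₀
      linarith)
  obtain ⟨r, hr, hball⟩ := Metric.mem_nhdsWithin_iff.1 hev
  obtain ⟨η, hη, hηe, hηε, hηr⟩ : ∃ η > 0, η ≤ e ∧ 2 * η ≤ ε * r ^ 2 ∧ 2 * η ≤ r := by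
    refine ⟨min e (min (ε * r ^ 2 / 2) (r / 2)), by positivity, min_le_left _ _, ?_, ?_⟩
    · have := (min_le_right e _).trans (min_le_left (ε * r ^ 2 / 2) (r / 2))
      linarith
    · have := (min_le_right e _).trans (min_le_right (ε * r ^ 2 / 2) (r / 2))
      linarith
  set w : (K → ℝ) → (L → ℝ) → ℝ := fun p q =>
    min (v p q) (ψ p - η + (C (η / 2) + 1) * ∑ l, |q l - q₀ l|) with hw
  have hwv : ∀ p q, w p q ≤ v p q := fun p q => min_le_left _ _
  have hs0 : ∀ q : L → ℝ, 0 ≤ ∑ l, |q l - q₀ l| :=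
    fun q => Finset.sum_nonneg fun _ _ => abs_nonneg _
  have hcase : ∀ p ∈ stdSimplex ℝ K, ∀ q ∈ stdSimplex ℝ L, w p q = v p q ∨ f p q ≤ w p q := by
    intro p hp q hq
    rcases le_or_gt (v p q) (ψ p - η + (C (η / 2) + 1) * ∑ l, |q l - q₀ l|) with h | h
    · exact Or.inl (min_eq_left h)
    right
    have hwe : w p q = ψ p - η + (C (η / 2) + 1) * ∑ l, |q l - q₀ l| := min_eq_right h.le
    have h1 := hvC (η / 2) (half_pos hη) p hp p hp q hq q₀ hq₀
    simp only [sub_self, abs_zero, Finset.sum_const_zero, zero_add] at h1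
    have h2 := htouch p hp
    have h3 : 0 ≤ ε * ∑ k, (p k - p₀ k) ^ 2 :=
      mul_nonneg hε.le (Finset.sum_nonneg fun _ _ => sq_nonneg _)
    have h4 := hs0 q
    have hdp : dist p p₀ < r := by
      refine dist_lt_of_sum_sq_lt hr (lt_of_mul_lt_mul_left ?_ hε.le)
      linarith
    have hdq : dist q q₀ < r := by
      refine (dist_pi_lt_iff hr).2 fun l => ?_
      have := Finset.single_le_sum (f := fun l => |q l - q₀ l|)
        (fun _ _ => abs_nonneg _) (Finset.mem_univ l)
      rw [Real.dist_eq]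
      linarith
    have h5 : e < ψ p - f p q := hball (a := (p, q))
      ⟨by rw [Metric.mem_ball, Prod.dist_eq]; exact max_lt hdp hdq, hp, hq⟩
    have h6 : 0 ≤ (C (η / 2) + 1) * ∑ l, |q l - q₀ l| :=
      mul_nonneg (by linarith [hC (η / 2)]) h4
    linarith
  have hwb : UnitBounded w := by
    refine fun p hp q hq => ⟨?_, (hwv p q).trans (hv.1.2 p hp q hq).2⟩
    rcases hcase p hp q hq with h | h
    · rw [h]
      exact (hv.1.2 p hp q hq).1
    · exact (hf.2 p hp q hq).1.trans h
  have hmb : UnitBounded fun p q => max (w p q) (f p q) := hwb.max hf.2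
  have hwplus : memCplus f w := by
    refine ⟨⟨?_, hwb⟩, fun q hq => ?_, fun p hp q hq => ?_⟩
    · exact hv.1.1.inf ((hψc'.sub continuousOn_const).add
        (Continuous.continuousOn (by fun_prop)))
    · exact (hv.2.1 q hq).inf ((hψ.add_const (-η)).add_const _)
    · rcases hcase p hp q hq with h | h
      · rw [h]
        refine (vexII_mono hmb hp (fun y _ => ?_) hq).trans (hv.2.2 p hp q hq)
        exact max_le_max (hwv p y) le_rfl
      · exact (vexII_le hmb hp hq).trans (max_le le_rfl h)
  have h1 := hleast w hwplus p₀ hp₀ q₀ hq₀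
  have h2 : w p₀ q₀ ≤ ψ p₀ - η + (C (η / 2) + 1) * ∑ l, |q₀ l - q₀ l| := min_le_right _ _
  simp only [sub_self, abs_zero, Finset.sum_const_zero, mul_zero, add_zero] at h2
  linarith

end touching

section existence

variable {K L : Type*} [Fintype K] [Fintype L]

/-- `𝒞⁺(f)` has a smallest element, and it is regular and II-convex. -/
lemma exists_least_memCplus {C : ℝ → ℝ} (hC : ∀ δ, 0 ≤ C δ) {f : (K → ℝ) → (L → ℝ) → ℝ}
    (hf : MemC f) (hfC : NearLip C f) :
    ∃ v, NearLip C v ∧ memCplus f v ∧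
      (∀ p ∈ stdSimplex ℝ K, ConvexOn ℝ (stdSimplex ℝ L) (v p)) ∧
      ∀ w, memCplus f w → ∀ p ∈ stdSimplex ℝ K, ∀ q ∈ stdSimplex ℝ L, v p q ≤ w p q := by
  let S : Set ((K → ℝ) → (L → ℝ) → ℝ) := {u | UnitBounded u ∧ NearLip C u ∧
    ∀ w, memCplus f w → ∀ p ∈ stdSimplex ℝ K, ∀ q ∈ stdSimplex ℝ L, u p q ≤ w p q}
  have hbot : (fun _ _ => -1) ∈ S := by
    refine ⟨fun p _ q _ => by norm_num, fun δ hδ p _ p' _ q _ q' _ => ?_,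
      fun w hw p hp q hq => (hw.1.2 p hp q hq).1⟩
    have h1 : 0 ≤ ∑ k, |p k - p' k| := Finset.sum_nonneg fun _ _ => abs_nonneg _
    have h2 : 0 ≤ ∑ l, |q l - q' l| := Finset.sum_nonneg fun _ _ => abs_nonneg _
    have := mul_nonneg (hC δ) (add_nonneg h1 h2)
    linarith
  let v : (K → ℝ) → (L → ℝ) → ℝ := fun p q => sSup ((fun u => u p q) '' S)
  have hle : ∀ u ∈ S, ∀ p ∈ stdSimplex ℝ K, ∀ q ∈ stdSimplex ℝ L, u p q ≤ v p q := by
    intro u hu p hp q hq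
    refine le_csSup ⟨1, ?_⟩ ⟨u, hu, rfl⟩
    rintro _ ⟨u', hu', rfl⟩
    exact (hu'.1 p hp q hq).2
  have hsup : ∀ p q, ∀ b, (∀ u ∈ S, u p q ≤ b) → v p q ≤ b := by
    intro p q b h
    refine csSup_le ⟨_, _, hbot, rfl⟩ ?_
    rintro _ ⟨u, hu, rfl⟩
    exact h u hu
  have hvb : UnitBounded v := fun p hp q hq =>
    ⟨hle _ hbot p hp q hq, hsup p q 1 fun u hu => (hu.1 p hp q hq).2⟩
  have hvC : NearLip C v := by
    intro δ hδ p hp p' hp' q hq q' hq'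
    rw [sub_le_iff_le_add]
    refine hsup p q _ fun u hu => ?_
    have h1 := hu.2.1 δ hδ p hp p' hp' q hq q' hq'
    have h2 := hle u hu p' hp' q' hq'
    linarith
  have hleast : ∀ w, memCplus f w → ∀ p ∈ stdSimplex ℝ K, ∀ q ∈ stdSimplex ℝ L,
      v p q ≤ w p q := fun w hw p hp q hq => hsup p q _ fun u hu => hu.2.2 w hw p hp q hq
  have hcav : cavI v ∈ S := ⟨hvb.cavI, hvC.cavI hC hvb, fun w hw p hp q hq =>
    cavI_le (hw.2.1 q hq) (fun x hx => hleast w hw x hx q hq) hp⟩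
  have hmb := hvb.max (show UnitBounded f from hf.2)
  have hvex : vexII (fun p q => max (v p q) (f p q)) ∈ S :=
    ⟨hmb.vexII, (hvC.max hfC).vexII hC hmb, fun w hw p hp q hq =>
      (vexII_mono hmb hp (fun y hy => max_le_max (hleast w hw p hp y hy) le_rfl) hq).trans
        (hw.2.2 p hp q hq)⟩
  have hvconc : ∀ q ∈ stdSimplex ℝ L, ConcaveOn ℝ (stdSimplex ℝ K) (fun p => v p q) :=
    fun q hq => (concaveOn_cavI (hvb.le_one hq)).congr fun p hp =>
      le_antisymm (hle _ hcav p hp q hq) (le_cavI (hvb.le_one hq) hp)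
  have hv : memCplus f v := ⟨⟨hvC.continuousOn, hvb⟩, hvconc, hle _ hvex⟩
  have hvexv : memCplus f (vexII v) := by
    refine ⟨⟨(hvC.vexII hC hvb).continuousOn, hvb.vexII⟩,
      fun q hq => concaveOn_vexII hvb hvconc hq, fun p hp q hq => ?_⟩
    have hmb' := hvb.vexII.max (show UnitBounded f from hf.2)
    refine le_vexII (convexOn_vexII hmb' hp) (fun y hy => ?_) hq
    refine le_trans ?_ (hv.2.2 p hp y hy)
    exact vexII_mono hmb' hp (fun z hz => max_le_max (vexII_le hvb hp hz) le_rfl) hy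
  exact ⟨v, hvC, hv, fun p hp => (convexOn_vexII hvb hp).congr fun q hq =>
    le_antisymm (vexII_le hvb hp hq) (hleast _ hvexv p hp q hq), hleast⟩

lemma le_cavI_of_least {C : ℝ → ℝ} (hC : ∀ δ, 0 ≤ C δ)
    {f v : (K → ℝ) → (L → ℝ) → ℝ} (hf : MemC f) (hfC : NearLip C f) (hvC : NearLip C v)
    (hv : memCplus f v)
    (hleast : ∀ w, memCplus f w → ∀ p ∈ stdSimplex ℝ K, ∀ q ∈ stdSimplex ℝ L, v p q ≤ w p q)
    {p : K → ℝ} (hp : p ∈ stdSimplex ℝ K) {q : L → ℝ} (hq : q ∈ stdSimplex ℝ L) :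
    v p q ≤ cavI (fun p q => min (v p q) (f p q)) p q := by
  have hmb : UnitBounded fun p q => min (v p q) (f p q) := UnitBounded.min hv.1.2 hf.2
  have hcc : ContinuousOn (fun x => cavI (fun p q => min (v p q) (f p q)) x q)
      (stdSimplex ℝ K) := MemC.continuousOn_left
    ⟨((hvC.min hfC).cavI hC hmb).continuousOn, hmb.cavI⟩ hq
  refine le_of_forall_pos_le_add fun ε hε => ?_
  obtain ⟨p₀, hp₀, hmax⟩ := (isCompact_stdSimplex ℝ K).exists_isMaxOn ⟨p, hp⟩
    (((hv.1.continuousOn_left hq).sub hcc).add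
      (Continuous.continuousOn (f := fun x : K → ℝ => ε * ∑ k, x k ^ 2) (by fun_prop)))
  obtain ⟨ψ, h1, h2, h3, h4⟩ := exists_touching (u := fun x => v x q)
    (concaveOn_cavI (hmb.le_one hq)) hcc (fun x hx => hmax hx)
  have h5 := le_of_touching_of_least hC hf hvC hv hleast hε hp₀ hq h1 h2 h3 h4
  have h6 : min (v p₀ q) (f p₀ q) ≤ cavI (fun p q => min (v p q) (f p q)) p₀ q :=
    le_cavI (g := fun p q => min (v p q) (f p q)) (hmb.le_one hq) hp₀
  rw [min_eq_left h5] at h6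
  have h7 : v p q - cavI (fun p q => min (v p q) (f p q)) p q + ε * ∑ k, p k ^ 2 ≤
    v p₀ q - cavI (fun p q => min (v p q) (f p q)) p₀ q + ε * ∑ k, p₀ k ^ 2 := hmax hp
  have h8 := mul_le_mul_of_nonneg_left (sum_sq_le_one hp₀) hε.le
  have h9 : 0 ≤ ε * ∑ k, p k ^ 2 :=
    mul_nonneg hε.le (Finset.sum_nonneg fun _ _ => sq_nonneg _)
  linarith

end existence

/-- **Mertens–Zamir system (Theorem MZ).** For each continuous `f : Δ(K)×Δ(L) → [-1,1]`
there is a unique continuous `w : Δ(K)×Δ(L) → [-1,1]` satisfying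
`w = vex_II max(w,f)` and `w = cav_I min(w,f)` on `Δ(K)×Δ(L)`; moreover this
solution equals pointwise both the supremum of `𝒞⁻(f)` and the infimum of `𝒞⁺(f)`. -/
theorem mertens_zamir_system {K L : Type*} [Fintype K] [Fintype L]
    (f : (K → ℝ) → (L → ℝ) → ℝ) (hf : MemC f) :
    ∃ w : (K → ℝ) → (L → ℝ) → ℝ, MemC w ∧
      (∀ p ∈ stdSimplex ℝ K, ∀ q ∈ stdSimplex ℝ L,
        w p q = vexII (fun p' q' => max (w p' q') (f p' q')) p q) ∧
      (∀ p ∈ stdSimplex ℝ K, ∀ q ∈ stdSimplex ℝ L,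
        w p q = cavI (fun p' q' => min (w p' q') (f p' q')) p q) ∧
      (∀ w' : (K → ℝ) → (L → ℝ) → ℝ, MemC w' →
        (∀ p ∈ stdSimplex ℝ K, ∀ q ∈ stdSimplex ℝ L,
          w' p q = vexII (fun p' q' => max (w' p' q') (f p' q')) p q) →
        (∀ p ∈ stdSimplex ℝ K, ∀ q ∈ stdSimplex ℝ L,
          w' p q = cavI (fun p' q' => min (w' p' q') (f p' q')) p q) →
        ∀ p ∈ stdSimplex ℝ K, ∀ q ∈ stdSimplex ℝ L, w' p q = w p q) ∧
      (∀ p ∈ stdSimplex ℝ K, ∀ q ∈ stdSimplex ℝ L,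
        w p q = sSup {y : ℝ | ∃ w' : (K → ℝ) → (L → ℝ) → ℝ, memCminus f w' ∧ y = w' p q}) ∧
      (∀ p ∈ stdSimplex ℝ K, ∀ q ∈ stdSimplex ℝ L,
        w p q = sInf {y : ℝ | ∃ w' : (K → ℝ) → (L → ℝ) → ℝ, memCplus f w' ∧ y = w' p q}) := by
  obtain ⟨C, hC, hfC⟩ := hf.exists_nearLip
  obtain ⟨v, hvC, hv, hconv, hleast⟩ := exists_least_memCplus hC hf hfC
  have hcav : ∀ p ∈ stdSimplex ℝ K, ∀ q ∈ stdSimplex ℝ L,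
      v p q ≤ cavI (fun p' q' => min (v p' q') (f p' q')) p q := fun p hp q hq =>
    le_cavI_of_least hC hf hfC hvC hv hleast hp hq
  have hvm : memCminus f v := ⟨hv.1, hconv, hcav⟩
  refine ⟨v, hv.1, fun p hp q hq => ?_, fun p hp q hq => ?_, fun w hw hwvex hwcav p hp q hq => ?_,
    fun p hp q hq => ?_, fun p hp q hq => ?_⟩
  · exact le_antisymm (le_vexII (hconv p hp) (fun y _ => le_max_left _ _) hq) (hv.2.2 p hp q hq)
  · exact le_antisymm (hcav p hp q hq)
      (cavI_le (hv.2.1 q hq) (fun x _ => min_le_left _ _) hp)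
  · have hmax : UnitBounded fun p q => max (w p q) (f p q) := UnitBounded.max hw.2 hf.2
    have hmin : UnitBounded fun p q => min (w p q) (f p q) := UnitBounded.min hw.2 hf.2
    have hwp : memCplus f w := ⟨hw, fun y hy => (concaveOn_cavI (hmin.le_one hy)).congr
      fun x hx => (hwcav x hx y hy).symm, fun x hx y hy => (hwvex x hx y hy).ge⟩
    have hwm : memCminus f w := ⟨hw, fun x hx => (convexOn_vexII hmax hx).congr
      fun y hy => (hwvex x hx y hy).symm, fun x hx y hy => (hwcav x hx y hy).le⟩
    exact le_antisymm (hwm.le_memCplus hf hv hp hq) (hleast w hwp p hp q hq)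
  · symm
    apply IsGreatest.csSup_eq
    refine ⟨⟨v, hvm, rfl⟩, ?_⟩
    rintro _ ⟨w, hw, rfl⟩
    exact hw.le_memCplus hf hv hp hq
  · symm
    apply IsLeast.csInf_eq
    refine ⟨⟨v, hv, rfl⟩, ?_⟩
    rintro _ ⟨w, hw, rfl⟩
    exact hleast w hw p hp q hq
end

section
/- Define recursively v̂_0 = 0 and v̂_{T+1} = Φ_{1/(T+1)}(v̂_T) for T ≥ 0 (these are the values of the T-stage nonrevealing games). Then for every T ≥ 1, v̂_T belongs to F; in particular each v̂_T is 3-Lipschitz on Δ(K)×Δ(L): |v̂_T(p,q) − v̂_T(p',q')| ≤ 3(‖p − p'‖ + ‖q − q'‖) for all p,p' ∈ Δ(K), q,q' ∈ Δ(L). -/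
/-- The `L¹` distance between two vectors indexed by a finite set. -/
noncomputable def dist1 {S : Type*} [Fintype S] (p p' : S → ℝ) : ℝ :=
  ∑ k, |p k - p' k|

/-- Row-vector times matrix multiplication, `(p A) k' = ∑ k, p k * A k k'`. -/
noncomputable def vecMulF {K : Type*} [Fintype K] (p : K → ℝ) (A : K → K → ℝ) : K → ℝ :=
  fun k' => ∑ k, p k * A k k'

/-- A recurrence structure on a finite set `K`: a partition of `K` into `R` nonempty
classes (given by the class map `cls`, surjectivity expressing nonemptiness of classes),
together with, for each class `r`, a probability vector `pstar r ∈ Δ(K)` supported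
in the class `r`. -/
structure RecStruct (K : Type*) [Fintype K] (R : ℕ) where
  cls : K → Fin R
  cls_surj : Function.Surjective cls
  pstar : Fin R → K → ℝ
  pstar_mem : ∀ r, pstar r ∈ stdSimplex ℝ K
  pstar_supp : ∀ r k, pstar r k ≠ 0 → cls k = r

namespace RecStruct

variable {K : Type*} [Fintype K] {R : ℕ}

/-- `lam rs p r` is the total mass given by `p` to the recurrence class `r`. -/
noncomputable def lam (rs : RecStruct K R) (p : K → ℝ) : Fin R → ℝ :=
  fun r => ∑ k, if rs.cls k = r then p k else 0

/-- The conditional law of `p` given the recurrence class `r` (equal to `pstar r` when the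
class has zero mass under `p`). -/
noncomputable def cond (rs : RecStruct K R) (p : K → ℝ) (r : Fin R) : K → ℝ :=
  if 0 < rs.lam p r then (fun k => if rs.cls k = r then p k / rs.lam p r else 0)
  else rs.pstar r

/-- The quantity `S(p,p') = ‖λ(p) - λ(p')‖₁ + ∑_{r : λ(p)^r λ(p')^r > 0} λ(p')^r ‖p_{|r} - p'_{|r}‖₁`. -/
noncomputable def Sdist (rs : RecStruct K R) (p p' : K → ℝ) : ℝ :=
  dist1 (rs.lam p) (rs.lam p') +
    ∑ r, if 0 < rs.lam p r * rs.lam p' r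
      then rs.lam p' r * dist1 (rs.cond p r) (rs.cond p' r) else 0

/-- The projection matrix `B`, whose row `k` is `pstar r` where `r` is the class of `k`. -/
noncomputable def Bmat (rs : RecStruct K R) : K → K → ℝ :=
  fun k k' => rs.pstar (rs.cls k) k'

/-- `P*`, the convex hull of the invariant measures of the classes. -/
noncomputable def Pset (rs : RecStruct K R) : Set (K → ℝ) :=
  convexHull ℝ (Set.range rs.pstar)

/-- `B^{-1}(p*) = {p ∈ Δ(K) : pB = p*}`. -/
def Binv (rs : RecStruct K R) (pst : K → ℝ) : Set (K → ℝ) :=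
  {p | p ∈ stdSimplex ℝ K ∧ vecMulF p rs.Bmat = pst}

/-- A stochastic matrix on `K` compatible with the recurrence structure: it is block
diagonal with respect to the partition and each `pstar r` is invariant. -/
structure IsCompatible (rs : RecStruct K R) (M : K → K → ℝ) : Prop where
  nonneg : ∀ k k', 0 ≤ M k k'
  rowSum : ∀ k, ∑ k', M k k' = 1
  block : ∀ k k', rs.cls k ≠ rs.cls k' → M k k' = 0
  invariant : ∀ r, vecMulF (rs.pstar r) M = rs.pstar r

end RecStruct

/-- `xOfp p x i = x(p)(i) = ∑ k, p^k x^k(i)`, the total probability of action `i`. -/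
noncomputable def xOfp {K I : Type*} [Fintype K] (p : K → ℝ) (x : K → I → ℝ) (i : I) : ℝ :=
  ∑ k, p k * x k i

/-- `pvec p x i = p⃗(x,i)`, the conditional law on `K` after action `i` is observed
(junk value when `x(p)(i) = 0`). -/
noncomputable def pvec {K I : Type*} [Fintype K] (p : K → ℝ) (x : K → I → ℝ) (i : I) : K → ℝ :=
  fun k => p k * x k i / xOfp p x i

/-- The set `NR(p)` of nonrevealing one-stage strategies at `p`:
profiles `x ∈ Δ(I)^K` such that `(p^k x^k(i))_k · B = x(p)(i) · (pB)` for every action `i`. -/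
def NR {K I : Type*} [Fintype K] [Fintype I] {R : ℕ}
    (rs : RecStruct K R) (p : K → ℝ) : Set (K → I → ℝ) :=
  {x | (∀ k, x k ∈ stdSimplex ℝ I) ∧
    ∀ i, vecMulF (fun k => p k * x k i) rs.Bmat = xOfp p x i • vecMulF p rs.Bmat}

/-- The expected one-stage payoff `G(p,q,x,y)`. -/
noncomputable def Gpay {K L I J : Type*} [Fintype K] [Fintype L] [Fintype I] [Fintype J]
    (g : K → L → I → J → ℝ) (p : K → ℝ) (q : L → ℝ) (x : K → I → ℝ) (y : L → J → ℝ) : ℝ :=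
  ∑ k, ∑ l, ∑ i, ∑ j, p k * q l * x k i * y l j * g k l i j

/-- The payoff of the one-shot game defining the operator `Φ_α`:
`α G(p,q,x,y) + (1-α) ∑_{i,j} x(p)(i) y(q)(j) f(p⃗(x,i)M, q⃗(y,j)N)`
(summands with zero coefficient vanish). -/
noncomputable def payoff {K L I J : Type*} [Fintype K] [Fintype L] [Fintype I] [Fintype J]
    (M : K → K → ℝ) (N : L → L → ℝ) (g : K → L → I → J → ℝ) (α : ℝ)
    (f : (K → ℝ) → (L → ℝ) → ℝ) (p : K → ℝ) (q : L → ℝ)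
    (x : K → I → ℝ) (y : L → J → ℝ) : ℝ :=
  α * Gpay g p q x y + (1 - α) * ∑ i, ∑ j,
    xOfp p x i * xOfp q y j * f (vecMulF (pvec p x i) M) (vecMulF (pvec q y j) N)

/-- The operator `Φ_α(f)(p,q) = sup_{x ∈ NR(p)} inf_{y ∈ NR(q)} [payoff]`. -/
noncomputable def Phi {K L I J : Type*} [Fintype K] [Fintype L] [Fintype I] [Fintype J]
    {RK RL : ℕ} (rsK : RecStruct K RK) (rsL : RecStruct L RL)
    (M : K → K → ℝ) (N : L → L → ℝ) (g : K → L → I → J → ℝ) (α : ℝ)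
    (f : (K → ℝ) → (L → ℝ) → ℝ) (p : K → ℝ) (q : L → ℝ) : ℝ :=
  sSup {v : ℝ | ∃ x ∈ (NR rsK p : Set (K → I → ℝ)),
    v = sInf {u : ℝ | ∃ y ∈ (NR rsL q : Set (L → J → ℝ)),
      u = payoff M N g α f p q x y}}

/-- The class `F` of functions `f : Δ(K)×Δ(L) → [-1,1]` such that
(i) `f(p,q) - f(p',q) ≤ S_K(p,p')`, (ii) `f(p,q) - f(p,q') ≤ S_L(q',q)`, and
(iii) for all `p* ∈ P*`, `q* ∈ Q*`, `f` is concave in `p` on `B^{-1}(p*)` and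
convex in `q` on `C^{-1}(q*)`. -/
structure MemF {K L : Type*} [Fintype K] [Fintype L] {RK RL : ℕ}
    (rsK : RecStruct K RK) (rsL : RecStruct L RL)
    (f : (K → ℝ) → (L → ℝ) → ℝ) : Prop where
  mem_Icc : ∀ p ∈ stdSimplex ℝ K, ∀ q ∈ stdSimplex ℝ L, f p q ∈ Set.Icc (-1 : ℝ) 1
  lipK : ∀ p ∈ stdSimplex ℝ K, ∀ p' ∈ stdSimplex ℝ K, ∀ q ∈ stdSimplex ℝ L,
    f p q - f p' q ≤ rsK.Sdist p p'
  lipL : ∀ p ∈ stdSimplex ℝ K, ∀ q ∈ stdSimplex ℝ L, ∀ q' ∈ stdSimplex ℝ L,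
    f p q - f p q' ≤ rsL.Sdist q' q
  concaveI : ∀ pst ∈ rsK.Pset, ∀ q ∈ stdSimplex ℝ L,
    ConcaveOn ℝ (rsK.Binv pst) (fun p => f p q)
  convexII : ∀ qst ∈ rsL.Pset, ∀ p ∈ stdSimplex ℝ K,
    ConvexOn ℝ (rsL.Binv qst) (fun q => f p q)

theorem mul_sSup_le_of_forall {S : Set ℝ} (hS : S.Nonempty) {t c : ℝ} (ht : 0 ≤ t)
    (h : ∀ a ∈ S, t * a ≤ c) : t * sSup S ≤ c := by
  rcases ht.eq_or_lt with rfl | ht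
  · obtain ⟨a, ha⟩ := hS
    simpa using h a ha
  · rw [mul_comm, ← le_div_iff₀ ht]
    refine csSup_le hS fun a ha => ?_
    rw [le_div_iff₀ ht, mul_comm]
    exact h a ha

theorem le_mul_sInf_of_forall {S : Set ℝ} (hS : S.Nonempty) {t c : ℝ} (ht : 0 ≤ t)
    (h : ∀ a ∈ S, c ≤ t * a) : c ≤ t * sInf S := by
  rcases ht.eq_or_lt with rfl | ht
  · obtain ⟨a, ha⟩ := hS
    simpa using h a ha
  · rw [mul_comm, ← div_le_iff₀ ht]
    refine le_csInf hS fun a ha => ?_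
    rw [div_le_iff₀ ht, mul_comm]
    exact h a ha

/-- The quantity `sup_{x ∈ X} inf_{y ∈ Y} H x y`. -/
noncomputable def lowerValue {A B : Type*} (X : Set A) (Y : Set B) (H : A → B → ℝ) : ℝ :=
  sSup {v : ℝ | ∃ x ∈ X, v = sInf {u : ℝ | ∃ y ∈ Y, u = H x y}}

section LowerValue

variable {A A' A'' B B' B'' : Type*}

theorem nonempty_section {Y : Set B} (hY : Y.Nonempty) {h : B → ℝ} :
    {u : ℝ | ∃ y ∈ Y, u = h y}.Nonempty :=
  let ⟨y, hy⟩ := hY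
  ⟨_, y, hy, rfl⟩

theorem bddBelow_section {Y : Set B} {h : B → ℝ} (hh : ∀ y ∈ Y, h y ∈ Set.Icc (-1 : ℝ) 1) :
    BddBelow {u : ℝ | ∃ y ∈ Y, u = h y} :=
  ⟨-1, by rintro _ ⟨y, hy, rfl⟩; exact (hh y hy).1⟩

theorem sInf_section_le {Y : Set B} {h : B → ℝ} (hh : ∀ y ∈ Y, h y ∈ Set.Icc (-1 : ℝ) 1)
    {y : B} (hy : y ∈ Y) : sInf {u : ℝ | ∃ y ∈ Y, u = h y} ≤ h y :=
  csInf_le (bddBelow_section hh) ⟨y, hy, rfl⟩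

theorem sInf_section_mem {Y : Set B} (hY : Y.Nonempty) {h : B → ℝ}
    (hh : ∀ y ∈ Y, h y ∈ Set.Icc (-1 : ℝ) 1) :
    sInf {u : ℝ | ∃ y ∈ Y, u = h y} ∈ Set.Icc (-1 : ℝ) 1 := by
  obtain ⟨y, hy⟩ := hY
  refine ⟨le_csInf ⟨_, y, hy, rfl⟩ ?_, (sInf_section_le hh hy).trans (hh y hy).2⟩
  rintro _ ⟨y, hy, rfl⟩
  exact (hh y hy).1

variable {X : Set A} {Y : Set B} {H : A → B → ℝ}

theorem sInf_section_le_lowerValue (hY : Y.Nonempty)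
    (hH : ∀ x ∈ X, ∀ y ∈ Y, H x y ∈ Set.Icc (-1 : ℝ) 1) {x : A} (hx : x ∈ X) :
    sInf {u : ℝ | ∃ y ∈ Y, u = H x y} ≤ lowerValue X Y H := by
  refine le_csSup ⟨1, ?_⟩ ⟨x, hx, rfl⟩
  rintro _ ⟨x, hx, rfl⟩
  exact (sInf_section_mem hY (hH x hx)).2

theorem lowerValue_mem_Icc (hX : X.Nonempty) (hY : Y.Nonempty)
    (hH : ∀ x ∈ X, ∀ y ∈ Y, H x y ∈ Set.Icc (-1 : ℝ) 1) :
    lowerValue X Y H ∈ Set.Icc (-1 : ℝ) 1 := by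
  obtain ⟨x, hx⟩ := hX
  refine ⟨(sInf_section_mem hY (hH x hx)).1.trans (sInf_section_le_lowerValue hY hH hx),
    csSup_le ⟨_, x, hx, rfl⟩ ?_⟩
  rintro _ ⟨x, hx, rfl⟩
  exact (sInf_section_mem hY (hH x hx)).2

/-- If strategies of the maximizer can be combined up to an error `D`, so can lower values. -/
theorem lowerValue_combine_left {X₁ : Set A'} {X₂ : Set A''} {H₁ : A' → B → ℝ}
    {H₂ : A'' → B → ℝ} (hY : Y.Nonempty) (hX₁ : X₁.Nonempty) (hX₂ : X₂.Nonempty)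
    (hH : ∀ x ∈ X, ∀ y ∈ Y, H x y ∈ Set.Icc (-1 : ℝ) 1)
    (hH₁ : ∀ x ∈ X₁, ∀ y ∈ Y, H₁ x y ∈ Set.Icc (-1 : ℝ) 1)
    (hH₂ : ∀ x ∈ X₂, ∀ y ∈ Y, H₂ x y ∈ Set.Icc (-1 : ℝ) 1)
    {t s D : ℝ} (ht : 0 ≤ t) (hs : 0 ≤ s)
    (h : ∀ x₁ ∈ X₁, ∀ x₂ ∈ X₂, ∃ x ∈ X, ∀ y ∈ Y, t * H₁ x₁ y + s * H₂ x₂ y - D ≤ H x y) :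
    t * lowerValue X₁ Y H₁ + s * lowerValue X₂ Y H₂ ≤ lowerValue X Y H + D := by
  obtain ⟨a₁, ha₁⟩ := hX₁
  obtain ⟨a₂, ha₂⟩ := hX₂
  rw [← le_sub_iff_add_le]
  refine mul_sSup_le_of_forall (nonempty_section ⟨a₁, ha₁⟩) ht ?_
  rintro _ ⟨x₁, hx₁, rfl⟩
  rw [le_sub_iff_add_le, add_comm, ← le_sub_iff_add_le]
  refine mul_sSup_le_of_forall (nonempty_section ⟨a₂, ha₂⟩) hs ?_
  rintro _ ⟨x₂, hx₂, rfl⟩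
  obtain ⟨x, hx, hxy⟩ := h x₁ hx₁ x₂ hx₂
  obtain ⟨b, hb⟩ := hY
  have key : t * sInf {u : ℝ | ∃ y ∈ Y, u = H₁ x₁ y} + s * sInf {u : ℝ | ∃ y ∈ Y, u = H₂ x₂ y} - D
      ≤ sInf {u : ℝ | ∃ y ∈ Y, u = H x y} := by
    refine le_csInf ⟨_, b, hb, rfl⟩ ?_
    rintro _ ⟨y, hy, rfl⟩
    have h₁ := mul_le_mul_of_nonneg_left (sInf_section_le (hH₁ x₁ hx₁) hy) ht
    have h₂ := mul_le_mul_of_nonneg_left (sInf_section_le (hH₂ x₂ hx₂) hy) hs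
    linarith [hxy y hy]
  have := sInf_section_le_lowerValue ⟨b, hb⟩ hH hx
  linarith

/-- If strategies of the minimizer can be combined up to an error `D`, so can lower values. -/
theorem lowerValue_combine_right {Y₁ : Set B'} {Y₂ : Set B''} {H₁ : A → B' → ℝ}
    {H₂ : A → B'' → ℝ} (hX : X.Nonempty) (hY₁ : Y₁.Nonempty) (hY₂ : Y₂.Nonempty)
    (hH : ∀ x ∈ X, ∀ y ∈ Y, H x y ∈ Set.Icc (-1 : ℝ) 1)
    (hH₁ : ∀ x ∈ X, ∀ y ∈ Y₁, H₁ x y ∈ Set.Icc (-1 : ℝ) 1)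
    (hH₂ : ∀ x ∈ X, ∀ y ∈ Y₂, H₂ x y ∈ Set.Icc (-1 : ℝ) 1)
    {t s D : ℝ} (ht : 0 ≤ t) (hs : 0 ≤ s)
    (h : ∀ y₁ ∈ Y₁, ∀ y₂ ∈ Y₂, ∃ y ∈ Y, ∀ x ∈ X, H x y ≤ t * H₁ x y₁ + s * H₂ x y₂ + D) :
    lowerValue X Y H ≤ t * lowerValue X Y₁ H₁ + s * lowerValue X Y₂ H₂ + D := by
  obtain ⟨a, ha⟩ := hX
  refine csSup_le ⟨_, a, ha, rfl⟩ ?_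
  rintro _ ⟨x, hx, rfl⟩
  obtain ⟨b₁, hb₁⟩ := hY₁
  obtain ⟨b₂, hb₂⟩ := hY₂
  have key : sInf {u : ℝ | ∃ y ∈ Y, u = H x y} - D -
      s * sInf {u : ℝ | ∃ y ∈ Y₂, u = H₂ x y} ≤ t * sInf {u : ℝ | ∃ y ∈ Y₁, u = H₁ x y} := by
    refine le_mul_sInf_of_forall (nonempty_section ⟨b₁, hb₁⟩) ht ?_
    rintro _ ⟨y₁, hy₁, rfl⟩
    rw [sub_le_comm]
    refine le_mul_sInf_of_forall (nonempty_section ⟨b₂, hb₂⟩) hs ?_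
    rintro _ ⟨y₂, hy₂, rfl⟩
    obtain ⟨y, hy, hxy⟩ := h y₁ hy₁ y₂ hy₂
    linarith [hxy x hx, sInf_section_le (hH x hx) hy]
  have h₁ := mul_le_mul_of_nonneg_left
    (sInf_section_le_lowerValue ⟨b₁, hb₁⟩ hH₁ hx) ht
  have h₂ := mul_le_mul_of_nonneg_left
    (sInf_section_le_lowerValue ⟨b₂, hb₂⟩ hH₂ hx) hs
  linarith

end LowerValue

section Vectors

variable {K : Type*} [Fintype K] {R : ℕ}

theorem dist1_comm (p p' : K → ℝ) : dist1 p p' = dist1 p' p :=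
  Finset.sum_congr rfl fun k _ => abs_sub_comm (p k) (p' k)

theorem dist1_nonneg (p p' : K → ℝ) : 0 ≤ dist1 p p' :=
  Finset.sum_nonneg fun _ _ => abs_nonneg _

theorem dist1_triangle (p p' p'' : K → ℝ) : dist1 p p'' ≤ dist1 p p' + dist1 p' p'' := by
  unfold dist1
  rw [← Finset.sum_add_distrib]
  exact Finset.sum_le_sum fun k _ => abs_sub_le _ _ _

theorem dist1_smul {t : ℝ} (ht : 0 ≤ t) (p p' : K → ℝ) :
    dist1 (t • p) (t • p') = t * dist1 p p' := by
  simp [dist1, Finset.mul_sum, ← mul_sub, abs_mul, abs_of_nonneg ht]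

theorem vecMulF_smul (t : ℝ) (p : K → ℝ) (A : K → K → ℝ) :
    vecMulF (t • p) A = t • vecMulF p A := by
  ext k'
  simp [vecMulF, Finset.mul_sum, mul_assoc]

theorem vecMulF_add (p p' : K → ℝ) (A : K → K → ℝ) :
    vecMulF (p + p') A = vecMulF p A + vecMulF p' A := by
  ext k'
  simp [vecMulF, ← Finset.sum_add_distrib, add_mul]

namespace RecStruct

variable (rs : RecStruct K R)

theorem lam_smul (t : ℝ) (p : K → ℝ) : rs.lam (t • p) = t • rs.lam p := by
  ext r
  simp [lam, Finset.mul_sum]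

theorem lam_add (p p' : K → ℝ) : rs.lam (p + p') = rs.lam p + rs.lam p' := by
  ext r
  simp only [lam, Pi.add_apply, ← Finset.sum_add_distrib]
  exact Finset.sum_congr rfl fun k _ => by split_ifs <;> simp

theorem sum_lam_mul (p : K → ℝ) (h : Fin R → ℝ) :
    ∑ r, rs.lam p r * h r = ∑ k, p k * h (rs.cls k) := by
  simp only [lam, Finset.sum_mul]
  rw [Finset.sum_comm]
  simp

theorem sum_lam (p : K → ℝ) : ∑ r, rs.lam p r = ∑ k, p k := by
  simpa using rs.sum_lam_mul p 1

theorem lam_nonneg {p : K → ℝ} (hp : ∀ k, 0 ≤ p k) (r : Fin R) : 0 ≤ rs.lam p r :=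
  Finset.sum_nonneg fun k _ => by split_ifs <;> simp [hp]

theorem le_lam {p : K → ℝ} (hp : ∀ k, 0 ≤ p k) (k : K) : p k ≤ rs.lam p (rs.cls k) := by
  have := Finset.single_le_sum (f := fun k' => if rs.cls k' = rs.cls k then p k' else 0)
    (fun k' _ => by split_ifs <;> simp [hp]) (Finset.mem_univ k)
  simpa [lam] using this

theorem eq_zero_of_lam_eq_zero {p : K → ℝ} (hp : ∀ k, 0 ≤ p k) {k : K}
    (h : rs.lam p (rs.cls k) = 0) : p k = 0 :=
  le_antisymm (h ▸ rs.le_lam hp k) (hp k)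

/-- Multiplying by a function of the class inside `lam`. -/
theorem lam_mul_cls (h : Fin R → ℝ) (p : K → ℝ) (r : Fin R) :
    rs.lam (fun k => h (rs.cls k) * p k) r = h r * rs.lam p r := by
  simp only [lam, Finset.mul_sum]
  refine Finset.sum_congr rfl fun k _ => ?_
  split_ifs with hk <;> simp [hk]

theorem dist1_lam_le (p p' : K → ℝ) : dist1 (rs.lam p) (rs.lam p') ≤ dist1 p p' := by
  have h : ∀ r, |rs.lam p r - rs.lam p' r| ≤ rs.lam (fun k => |p k - p' k|) r := fun r => by
    simp only [lam, ← Finset.sum_sub_distrib]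
    refine (Finset.abs_sum_le_sum_abs _ _).trans (Finset.sum_le_sum fun k _ => ?_)
    split_ifs <;> simp
  exact (Finset.sum_le_sum fun r _ => h r).trans (rs.sum_lam _).le

variable {rs}

theorem lam_vecMulF {A : K → K → ℝ} (hrow : ∀ k, ∑ k', A k k' = 1)
    (hblock : ∀ k k', rs.cls k ≠ rs.cls k' → A k k' = 0) (p : K → ℝ) :
    rs.lam (vecMulF p A) = rs.lam p := by
  ext r
  simp only [lam, vecMulF, ← Finset.sum_filter]
  rw [Finset.sum_comm, Finset.sum_filter]
  refine Finset.sum_congr rfl fun k _ => ?_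
  rw [← Finset.mul_sum, Finset.sum_filter]
  have h : ∀ k', (if rs.cls k' = r then A k k' else 0) = if rs.cls k = r then A k k' else 0 := by
    intro k'
    by_cases hk : rs.cls k = rs.cls k'
    · rw [hk]
    · simp [hblock k k' hk]
  simp only [h]
  split_ifs <;> simp [hrow]

theorem IsCompatible.lam_vecMulF {M : K → K → ℝ} (hM : rs.IsCompatible M) (p : K → ℝ) :
    rs.lam (vecMulF p M) = rs.lam p :=
  RecStruct.lam_vecMulF hM.rowSum hM.block p

variable (rs) in
theorem lam_vecMulF_Bmat (p : K → ℝ) : rs.lam (vecMulF p rs.Bmat) = rs.lam p := by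
  refine RecStruct.lam_vecMulF (fun k => (rs.pstar_mem _).2) (fun k k' hk => ?_) p
  by_contra h
  exact hk (rs.pstar_supp _ _ h).symm

variable (rs) in
theorem vecMulF_Bmat_apply (p : K → ℝ) (k' : K) :
    vecMulF p rs.Bmat k' = rs.lam p (rs.cls k') * rs.pstar (rs.cls k') k' := by
  simp only [vecMulF, Bmat, lam, Finset.sum_mul]
  refine Finset.sum_congr rfl fun k _ => ?_
  by_cases hk : rs.cls k = rs.cls k'
  · simp [hk]
  · have : rs.pstar (rs.cls k) k' = 0 := by
      by_contra h
      exact hk (rs.pstar_supp _ _ h).symm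
    simp [hk, this]

theorem IsCompatible.vecMulF_mem {M : K → K → ℝ} (hM : rs.IsCompatible M) {p : K → ℝ}
    (hp : p ∈ stdSimplex ℝ K) : vecMulF p M ∈ stdSimplex ℝ K := by
  refine ⟨fun k' => Finset.sum_nonneg fun k _ => mul_nonneg (hp.1 k) (hM.nonneg k k'), ?_⟩
  rw [← rs.sum_lam, hM.lam_vecMulF, rs.sum_lam, hp.2]

theorem IsCompatible.dist1_vecMulF_le {M : K → K → ℝ} (hM : rs.IsCompatible M) (p p' : K → ℝ) :
    dist1 (vecMulF p M) (vecMulF p' M) ≤ dist1 p p' := by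
  have h : ∀ k', |vecMulF p M k' - vecMulF p' M k'| ≤ ∑ k, |p k - p' k| * M k k' := fun k' => by
    simp only [vecMulF, ← Finset.sum_sub_distrib, ← sub_mul]
    refine (Finset.abs_sum_le_sum_abs _ _).trans (Finset.sum_le_sum fun k _ => ?_)
    rw [abs_mul, abs_of_nonneg (hM.nonneg k k')]
  refine (Finset.sum_le_sum fun k' _ => h k').trans ?_
  rw [Finset.sum_comm]
  simp [← Finset.mul_sum, hM.rowSum, dist1]

variable (rs) in
/-- `p` and `w` have the same conditional laws on all classes charged by both. -/
def SameCond (p w : K → ℝ) : Prop :=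
  ∀ k, rs.lam p (rs.cls k) * w k = rs.lam w (rs.cls k) * p k

theorem SameCond.smul {p w : K → ℝ} (h : rs.SameCond p w) (t : ℝ) :
    rs.SameCond (t • p) (t • w) := fun k => by
  simp only [lam_smul, Pi.smul_apply, smul_eq_mul]
  linear_combination t ^ 2 * h k

theorem SameCond.vecMulF {M : K → K → ℝ} (hM : rs.IsCompatible M) {p w : K → ℝ}
    (h : rs.SameCond p w) : rs.SameCond (vecMulF p M) (vecMulF w M) := fun k' => by
  simp only [hM.lam_vecMulF, _root_.vecMulF, Finset.mul_sum]
  refine Finset.sum_congr rfl fun k _ => ?_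
  by_cases hk : rs.cls k = rs.cls k'
  · rw [← hk]
    linear_combination M k k' * h k
  · simp [hM.block k k' hk]

theorem SameCond.dist1_le {p w : K → ℝ} (hp : ∀ k, 0 ≤ p k) (hw : ∀ k, 0 ≤ w k)
    (h : rs.SameCond p w) : dist1 p w ≤ dist1 (rs.lam p) (rs.lam w) := by
  have h₁ : ∀ k, |p k - w k| ≤
      p k * (if rs.lam p (rs.cls k) = 0 then 0 else
        |rs.lam p (rs.cls k) - rs.lam w (rs.cls k)| / rs.lam p (rs.cls k)) +
      w k * (if rs.lam p (rs.cls k) = 0 then 1 else 0) := fun k => by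
    split_ifs with h0
    · simp [rs.eq_zero_of_lam_eq_zero hp h0, abs_of_nonneg (hw k)]
    · have hpos : 0 < rs.lam p (rs.cls k) := lt_of_le_of_ne (rs.lam_nonneg hp _) (Ne.symm h0)
      rw [mul_zero, add_zero, mul_div_assoc', le_div_iff₀ hpos, ← abs_of_pos hpos, ← abs_mul,
        abs_of_pos hpos]
      nth_rewrite 2 [← abs_of_nonneg (hp k)]
      rw [← abs_mul]
      refine le_of_eq (congrArg _ ?_)
      linear_combination -h k
  refine (Finset.sum_le_sum fun k _ => h₁ k).trans ?_
  rw [Finset.sum_add_distrib, ← rs.sum_lam_mul p fun r => if rs.lam p r = 0 then 0 else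
      |rs.lam p r - rs.lam w r| / rs.lam p r,
    ← rs.sum_lam_mul w fun r => if rs.lam p r = 0 then 1 else 0, ← Finset.sum_add_distrib]
  refine Finset.sum_le_sum fun r _ => ?_
  split_ifs with h0
  · simp [h0, abs_of_nonneg (rs.lam_nonneg hw r)]
  · rw [mul_div_cancel₀ _ h0]
    simp

end RecStruct

end Vectors

section ConcLip

variable {K : Type*} [Fintype K] {R : ℕ}

theorem inv_smul_mem_stdSimplex {v : K → ℝ} (hv : ∀ k, 0 ≤ v k) (h : 0 < ∑ k, v k) :
    (∑ k, v k)⁻¹ • v ∈ stdSimplex ℝ K := by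
  refine ⟨fun k => mul_nonneg (inv_nonneg.2 h.le) (hv k), ?_⟩
  simp [← Finset.mul_sum, h.ne']

/-- Regularity of a function of one variable: boundedness by `1`, the Lipschitz property in the
conditional laws and in the class masses, and concavity at fixed class masses. -/
structure ConcLip (rs : RecStruct K R) (φ : (K → ℝ) → ℝ) : Prop where
  abs_le : ∀ p ∈ stdSimplex ℝ K, |φ p| ≤ 1
  lip : ∀ p ∈ stdSimplex ℝ K, ∀ p' ∈ stdSimplex ℝ K, rs.lam p = rs.lam p' →
    φ p - φ p' ≤ dist1 p p'
  lip_lam : ∀ p ∈ stdSimplex ℝ K, ∀ p' ∈ stdSimplex ℝ K, rs.SameCond p p' →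
    φ p - φ p' ≤ dist1 (rs.lam p) (rs.lam p')
  conc : ∀ p ∈ stdSimplex ℝ K, ∀ p' ∈ stdSimplex ℝ K, rs.lam p = rs.lam p' →
    ∀ t s : ℝ, 0 ≤ t → 0 ≤ s → t + s = 1 → t * φ p + s * φ p' ≤ φ (t • p + s • p')

theorem abs_sum_mul_le {J : Type*} [Fintype J] {b h : J → ℝ} {D : ℝ}
    (hb : ∀ j, 0 ≤ b j) (hh : ∀ j, 0 < b j → |h j| ≤ D) :
    |∑ j, b j * h j| ≤ (∑ j, b j) * D := by
  rw [Finset.sum_mul]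
  refine (Finset.abs_sum_le_sum_abs _ _).trans (Finset.sum_le_sum fun j _ => ?_)
  rw [abs_mul, abs_of_nonneg (hb j)]
  rcases (hb j).eq_or_lt with h0 | h0
  · simp [← h0]
  · exact mul_le_mul_of_nonneg_left (hh j h0) h0.le

theorem sum_mul_le_sum_mul_of_pos {J : Type*} [Fintype J] {b h h' : J → ℝ}
    (hb : ∀ j, 0 ≤ b j) (hh : ∀ j, 0 < b j → h j ≤ h' j) :
    ∑ j, b j * h j ≤ ∑ j, b j * h' j := by
  refine Finset.sum_le_sum fun j _ => ?_
  rcases (hb j).eq_or_lt with h0 | h0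
  · simp [← h0]
  · exact mul_le_mul_of_nonneg_left (hh j h0) h0.le

theorem ConcLip.sum {J : Type*} [Fintype J] {rs : RecStruct K R} {b : J → ℝ}
    (hb : b ∈ stdSimplex ℝ J) {φ : J → (K → ℝ) → ℝ} (hφ : ∀ j, 0 < b j → ConcLip rs (φ j)) :
    ConcLip rs (fun p => ∑ j, b j * φ j p) := by
  have hconst : ∀ D : ℝ, ∑ j, b j * D = D := fun D => by rw [← Finset.sum_mul, hb.2, one_mul]
  refine ⟨fun p hp => ?_, fun p hp p' hp' h => ?_, fun p hp p' hp' h => ?_,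
    fun p hp p' hp' h t s ht hs hts => ?_⟩
  · simpa [hb.2] using abs_sum_mul_le hb.1 fun j hj => (hφ j hj).abs_le p hp
  · rw [← Finset.sum_sub_distrib, ← hconst (dist1 p p')]
    simp only [← mul_sub]
    exact sum_mul_le_sum_mul_of_pos hb.1 fun j hj => (hφ j hj).lip p hp p' hp' h
  · rw [← Finset.sum_sub_distrib, ← hconst (dist1 (rs.lam p) (rs.lam p'))]
    simp only [← mul_sub]
    exact sum_mul_le_sum_mul_of_pos hb.1 fun j hj => (hφ j hj).lip_lam p hp p' hp' h
  · rw [Finset.mul_sum, Finset.mul_sum, ← Finset.sum_add_distrib]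
    refine le_trans (le_of_eq (Finset.sum_congr rfl fun j _ => ?_))
      (sum_mul_le_sum_mul_of_pos hb.1 fun j hj => (hφ j hj).conc p hp p' hp' h t s ht hs hts)
    ring

/-- The positively homogeneous extension of `p ↦ φ (p M)` to nonnegative vectors. -/
noncomputable def persp (M : K → K → ℝ) (φ : (K → ℝ) → ℝ) (v : K → ℝ) : ℝ :=
  (∑ k, v k) * φ (vecMulF ((∑ k, v k)⁻¹ • v) M)

theorem eq_zero_of_sum_eq_zero {v : K → ℝ} (hv : ∀ k, 0 ≤ v k) (h : ∑ k, v k = 0) : v = 0 := by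
  ext k
  exact (Finset.sum_eq_zero_iff_of_nonneg fun k _ => hv k).1 h k (Finset.mem_univ k)

theorem persp_smul (M : K → K → ℝ) (φ : (K → ℝ) → ℝ) (t : ℝ) (v : K → ℝ) :
    persp M φ (t • v) = t * persp M φ v := by
  rcases eq_or_ne t 0 with rfl | ht
  · simp [persp]
  · have : (∑ k, (t • v) k)⁻¹ • (t • v) = (∑ k, v k)⁻¹ • v := by
      simp only [Pi.smul_apply, smul_eq_mul, ← Finset.mul_sum, smul_smul, mul_inv]
      congr 1
      field_simp
    rw [persp, this]
    simp [persp, ← Finset.mul_sum, mul_assoc]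

namespace ConcLip

variable {rs : RecStruct K R} {M : K → K → ℝ} {φ : (K → ℝ) → ℝ}

theorem abs_persp_le (hφ : ConcLip rs φ) (hM : rs.IsCompatible M) {v : K → ℝ}
    (hv : ∀ k, 0 ≤ v k) : |persp M φ v| ≤ ∑ k, v k := by
  have h0 : 0 ≤ ∑ k, v k := Finset.sum_nonneg fun k _ => hv k
  rw [persp, abs_mul, abs_of_nonneg h0]
  rcases h0.eq_or_lt with h | h
  · simp [← h]
  · exact mul_le_of_le_one_right h0 (hφ.abs_le _ (hM.vecMulF_mem (inv_smul_mem_stdSimplex hv h)))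

theorem persp_sub_le_of {v v' : K → ℝ} {D : ℝ}
    (hv : ∀ k, 0 ≤ v k) (hv' : ∀ k, 0 ≤ v' k) (hsum : ∑ k, v k = ∑ k, v' k) (hD : 0 ≤ D)
    (h : ∀ p ∈ stdSimplex ℝ K, ∀ p' ∈ stdSimplex ℝ K, ∀ a : ℝ, 0 < a → p = a⁻¹ • v →
      p' = a⁻¹ • v' → φ (vecMulF p M) - φ (vecMulF p' M) ≤ a⁻¹ * D) :
    persp M φ v - persp M φ v' ≤ D := by
  have h0 : 0 ≤ ∑ k, v k := Finset.sum_nonneg fun k _ => hv k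
  rcases h0.eq_or_lt with h1 | h1
  · simp [persp, ← h1, ← hsum, hD]
  · have h2 := h _ (inv_smul_mem_stdSimplex hv h1) _
      (inv_smul_mem_stdSimplex hv' (hsum ▸ h1)) _ h1 rfl (by rw [hsum])
    rw [persp, persp, ← hsum, ← mul_sub]
    rw [← hsum] at h2
    calc _ ≤ (∑ k, v k) * ((∑ k, v k)⁻¹ * D) := mul_le_mul_of_nonneg_left h2 h0
      _ = D := by field_simp

theorem persp_sub_le (hφ : ConcLip rs φ) (hM : rs.IsCompatible M) {v v' : K → ℝ}
    (hv : ∀ k, 0 ≤ v k) (hv' : ∀ k, 0 ≤ v' k) (hsum : ∑ k, v k = ∑ k, v' k)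
    (h : rs.lam v = rs.lam v') : persp M φ v - persp M φ v' ≤ dist1 v v' := by
  refine persp_sub_le_of hv hv' hsum (dist1_nonneg _ _) ?_
  rintro p hp p' hp' a ha hpv hpv'
  have hlam : rs.lam p = rs.lam p' := by
    rw [hpv, hpv', rs.lam_smul, rs.lam_smul, h]
  refine (hφ.lip _ (hM.vecMulF_mem hp) _ (hM.vecMulF_mem hp')
    (by rw [hM.lam_vecMulF, hM.lam_vecMulF, hlam])).trans ?_
  refine (hM.dist1_vecMulF_le _ _).trans (le_of_eq ?_)
  rw [hpv, hpv', dist1_smul (inv_nonneg.2 ha.le)]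

theorem persp_sub_le_lam (hφ : ConcLip rs φ) (hM : rs.IsCompatible M) {v v' : K → ℝ}
    (hv : ∀ k, 0 ≤ v k) (hv' : ∀ k, 0 ≤ v' k) (hsum : ∑ k, v k = ∑ k, v' k)
    (h : rs.SameCond v v') : persp M φ v - persp M φ v' ≤ dist1 (rs.lam v) (rs.lam v') := by
  refine persp_sub_le_of hv hv' hsum (dist1_nonneg _ _) ?_
  rintro p hp p' hp' a ha hpv hpv'
  have hcond : rs.SameCond p p' := by
    rw [hpv, hpv']
    exact h.smul _
  refine (hφ.lip_lam _ (hM.vecMulF_mem hp) _ (hM.vecMulF_mem hp') (hcond.vecMulF hM)).trans ?_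
  rw [hM.lam_vecMulF, hM.lam_vecMulF, hpv, hpv', rs.lam_smul, rs.lam_smul,
    dist1_smul (inv_nonneg.2 ha.le)]

theorem persp_add_le (hφ : ConcLip rs φ) (hM : rs.IsCompatible M) {v v' : K → ℝ}
    (hv : ∀ k, 0 ≤ v k) (hv' : ∀ k, 0 ≤ v' k)
    (h : (∑ k, v' k) • rs.lam v = (∑ k, v k) • rs.lam v') :
    persp M φ v + persp M φ v' ≤ persp M φ (v + v') := by
  have h0 : 0 ≤ ∑ k, v k := Finset.sum_nonneg fun k _ => hv k
  have h0' : 0 ≤ ∑ k, v' k := Finset.sum_nonneg fun k _ => hv' k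
  rcases h0.eq_or_lt with h1 | h1
  · simp [eq_zero_of_sum_eq_zero hv h1.symm, persp]
  rcases h0'.eq_or_lt with h1' | h1'
  · simp [eq_zero_of_sum_eq_zero hv' h1'.symm, persp]
  have hs : ∑ k, (v + v') k = ∑ k, v k + ∑ k, v' k := by simp [Finset.sum_add_distrib]
  simp only [persp, hs]
  set m := ∑ k, v k
  set m' := ∑ k, v' k
  have hmm : 0 < m + m' := by positivity
  have key := hφ.conc _ (hM.vecMulF_mem (inv_smul_mem_stdSimplex hv h1)) _
    (hM.vecMulF_mem (inv_smul_mem_stdSimplex hv' h1')) (by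
      rw [hM.lam_vecMulF, hM.lam_vecMulF, rs.lam_smul, rs.lam_smul]
      change m⁻¹ • rs.lam v = m'⁻¹ • rs.lam v'
      rw [inv_smul_eq_iff₀ h1.ne', smul_comm, ← h, inv_smul_smul₀ h1'.ne'])
    (m / (m + m')) (m' / (m + m')) (by positivity) (by positivity) (by field_simp)
  rw [← vecMulF_smul, ← vecMulF_smul, ← vecMulF_add, smul_smul, smul_smul] at key
  have e : ∀ a : ℝ, 0 < a → a / (m + m') * a⁻¹ = (m + m')⁻¹ := fun a ha => by field_simp
  change m / (m + m') * φ (vecMulF (m⁻¹ • v) M) + m' / (m + m') * φ (vecMulF (m'⁻¹ • v') M) ≤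
    φ (vecMulF ((m / (m + m') * m⁻¹) • v + (m' / (m + m') * m'⁻¹) • v') M) at key
  rw [e m h1, e m' h1', ← smul_add] at key
  have := mul_le_mul_of_nonneg_left key hmm.le
  refine le_trans (le_of_eq ?_) this
  field_simp

end ConcLip

end ConcLip

section Strategies

variable {K I : Type*} [Fintype K] [Fintype I] {R : ℕ}

/-- The joint law of state and action induced by a prior and a strategy. -/
def jointLaw (p : K → ℝ) (x : K → I → ℝ) (k : K) (i : I) : ℝ := p k * x k i

/-- The joint laws on states and actions induced by the nonrevealing strategies at `p`. -/
structure IsNRLaw (rs : RecStruct K R) (p : K → ℝ) (μ : K → I → ℝ) : Prop where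
  nonneg : ∀ k i, 0 ≤ μ k i
  sum_right : ∀ k, ∑ i, μ k i = p k
  lam_eq : ∀ i, rs.lam (fun k => μ k i) = (∑ k, μ k i) • rs.lam p

variable {rs : RecStruct K R} {p p' : K → ℝ}

theorem isNRLaw_jointLaw (hp : p ∈ stdSimplex ℝ K) {x : K → I → ℝ} (hx : x ∈ NR rs p) :
    IsNRLaw rs p (jointLaw p x) where
  nonneg k i := mul_nonneg (hp.1 k) ((hx.1 k).1 i)
  sum_right k := by simp [jointLaw, ← Finset.mul_sum, (hx.1 k).2]
  lam_eq i := by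
    have := congrArg rs.lam (hx.2 i)
    rwa [rs.lam_smul, rs.lam_vecMulF_Bmat, rs.lam_vecMulF_Bmat] at this

theorem IsNRLaw.exists_strategy [Nonempty I] {μ : K → I → ℝ} (h : IsNRLaw rs p μ) :
    ∃ x ∈ NR rs p, jointLaw p x = μ := by
  classical
  obtain ⟨i₀⟩ := ‹Nonempty I›
  set x : K → I → ℝ := fun k => if p k = 0 then Pi.single i₀ 1 else fun i => μ k i / p k with hx
  have hzero : ∀ k, p k = 0 → ∀ i, μ k i = 0 := fun k hk i =>
    (Finset.sum_eq_zero_iff_of_nonneg fun i _ => h.nonneg k i).1 ((h.sum_right k).trans hk) i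
      (Finset.mem_univ i)
  have hp : ∀ k, 0 ≤ p k := fun k => h.sum_right k ▸ Finset.sum_nonneg fun i _ => h.nonneg k i
  have hμ : ∀ k i, p k * x k i = μ k i := fun k i => by
    by_cases hk : p k = 0
    · simp [hk, hzero k hk i]
    · simp [hx, hk, mul_div_cancel₀]
  refine ⟨x, ⟨fun k => ?_, fun i => ?_⟩, funext fun k => funext fun i => hμ k i⟩
  · by_cases hk : p k = 0
    · simpa [hx, hk] using single_mem_stdSimplex ℝ i₀
    · simp only [hx, hk, if_false]
      refine ⟨fun i => div_nonneg (h.nonneg k i) (hp k), ?_⟩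
      rw [← Finset.sum_div, h.sum_right, div_self hk]
  · ext k'
    have e := congrFun (h.lam_eq i) (rs.cls k')
    simp only [hμ, xOfp, Pi.smul_apply, smul_eq_mul, rs.vecMulF_Bmat_apply] at e ⊢
    rw [e, mul_assoc]

theorem IsNRLaw.sum_eq_one (hp : p ∈ stdSimplex ℝ K) {μ : K → I → ℝ} (h : IsNRLaw rs p μ) :
    ∑ i, ∑ k, μ k i = 1 := by
  rw [Finset.sum_comm]
  simp only [h.sum_right, hp.2]

theorem nr_nonempty [Nonempty I] (rs : RecStruct K R) (hp : p ∈ stdSimplex ℝ K) :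
    (NR rs p : Set (K → I → ℝ)).Nonempty := by
  classical
  obtain ⟨i₀⟩ := ‹Nonempty I›
  refine ⟨fun _ => Pi.single i₀ 1, fun k => single_mem_stdSimplex ℝ i₀, fun i => ?_⟩
  ext k'
  simp only [vecMulF, xOfp, Pi.smul_apply, smul_eq_mul, ← Finset.sum_mul, Finset.mul_sum]
  by_cases hi : i = i₀
  · subst hi
    simp [hp.2]
  · simp [hi]

/-- The stage payoff as a function of the joint law `μ` of state and action of one player,
where `c` is the current reward and `φ` the continuation payoff. -/
noncomputable def lawPayoff (M : K → K → ℝ) (α : ℝ) (c : K → I → ℝ) (φ : (K → ℝ) → ℝ)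
    (μ : K → I → ℝ) : ℝ :=
  ∑ i, (α * ∑ k, μ k i * c k i + (1 - α) * persp M φ (fun k => μ k i))

variable {M : K → K → ℝ} {α : ℝ} {c : K → I → ℝ} {φ : (K → ℝ) → ℝ} {μ μ' : K → I → ℝ}

theorem abs_lawPayoff_le (hM : rs.IsCompatible M) (hα : α ∈ Set.Icc (0 : ℝ) 1)
    (hc : ∀ k i, |c k i| ≤ 1) (hφ : ConcLip rs φ) (hp : p ∈ stdSimplex ℝ K)
    (hμ : IsNRLaw rs p μ) : |lawPayoff M α c φ μ| ≤ 1 := by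
  rw [← hμ.sum_eq_one hp]
  refine (Finset.abs_sum_le_sum_abs _ _).trans (Finset.sum_le_sum fun i _ => ?_)
  have h₁ := abs_le.1 (abs_sum_mul_le (b := fun k => μ k i) (h := fun k => c k i)
    (fun k => hμ.nonneg k i) fun k _ => hc k i)
  have h₂ := abs_le.1 (hφ.abs_persp_le hM (v := fun k => μ k i) fun k => hμ.nonneg k i)
  have h0 := hα.1
  have h1 : 0 ≤ 1 - α := sub_nonneg.2 hα.2
  rw [abs_le]
  constructor <;>
    nlinarith [mul_le_mul_of_nonneg_left h₁.1 h0, mul_le_mul_of_nonneg_left h₁.2 h0,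
      mul_le_mul_of_nonneg_left h₂.1 h1, mul_le_mul_of_nonneg_left h₂.2 h1]

theorem lawPayoff_sub_le (hα : α ∈ Set.Icc (0 : ℝ) 1) (hc : ∀ k i, |c k i| ≤ 1) {D : ℝ}
    {d : I → ℝ} (hd : ∑ i, d i ≤ D) (h₁ : ∀ i, dist1 (fun k => μ k i) (fun k => μ' k i) ≤ d i)
    (h₂ : ∀ i, persp M φ (fun k => μ k i) - persp M φ (fun k => μ' k i) ≤ d i) :
    lawPayoff M α c φ μ - lawPayoff M α c φ μ' ≤ D := by
  refine le_trans ?_ hd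
  rw [lawPayoff, lawPayoff, ← Finset.sum_sub_distrib]
  refine Finset.sum_le_sum fun i _ => ?_
  have h₃ : ∑ k, μ k i * c k i - ∑ k, μ' k i * c k i ≤ d i := by
    refine le_trans ?_ (h₁ i)
    rw [← Finset.sum_sub_distrib]
    refine Finset.sum_le_sum fun k _ => ?_
    rw [← sub_mul]
    refine (le_abs_self _).trans ?_
    rw [abs_mul]
    exact mul_le_of_le_one_right (abs_nonneg _) (hc k i)
  nlinarith [mul_le_mul_of_nonneg_left h₃ hα.1,
    mul_le_mul_of_nonneg_left (h₂ i) (sub_nonneg.2 hα.2)]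

theorem le_lawPayoff_combine (hM : rs.IsCompatible M) (hα : α ∈ Set.Icc (0 : ℝ) 1)
    (hφ : ConcLip rs φ) (hμ : IsNRLaw rs p μ) (hμ' : IsNRLaw rs p' μ')
    (h : rs.lam p = rs.lam p') {t s : ℝ} (ht : 0 ≤ t) (hs : 0 ≤ s) :
    t * lawPayoff M α c φ μ + s * lawPayoff M α c φ μ' ≤ lawPayoff M α c φ (t • μ + s • μ') := by
  rw [lawPayoff, lawPayoff, lawPayoff, Finset.mul_sum, Finset.mul_sum, ← Finset.sum_add_distrib]
  refine Finset.sum_le_sum fun i _ => ?_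
  have h₁ : ∑ k, (t • μ + s • μ') k i * c k i =
      t * ∑ k, μ k i * c k i + s * ∑ k, μ' k i * c k i := by
    rw [Finset.mul_sum, Finset.mul_sum, ← Finset.sum_add_distrib]
    refine Finset.sum_congr rfl fun k _ => ?_
    simp only [Pi.add_apply, Pi.smul_apply, smul_eq_mul]
    ring
  have h₂ := hφ.persp_add_le hM (v := t • fun k => μ k i) (v' := s • fun k => μ' k i)
    (fun k => mul_nonneg ht (hμ.nonneg k i)) (fun k => mul_nonneg hs (hμ'.nonneg k i)) (by
      rw [rs.lam_smul, rs.lam_smul, hμ.lam_eq, hμ'.lam_eq, h]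
      ext r
      simp only [Pi.smul_apply, smul_eq_mul, ← Finset.mul_sum]
      ring)
  rw [persp_smul, persp_smul] at h₂
  have h₃ := mul_le_mul_of_nonneg_left h₂ (sub_nonneg.2 hα.2)
  have e : (fun k => (t • μ + s • μ') k i) = (t • fun k => μ k i) + s • fun k => μ' k i := rfl
  rw [h₁, e]
  linarith

theorem IsNRLaw.combine (hμ : IsNRLaw rs p μ) (hμ' : IsNRLaw rs p' μ')
    (h : rs.lam p = rs.lam p') {t s : ℝ} (ht : 0 ≤ t) (hs : 0 ≤ s) (hts : t + s = 1) :
    IsNRLaw rs (t • p + s • p') (t • μ + s • μ') where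
  nonneg k i := add_nonneg (mul_nonneg ht (hμ.nonneg k i)) (mul_nonneg hs (hμ'.nonneg k i))
  sum_right k := by
    simp [Finset.sum_add_distrib, ← Finset.mul_sum, hμ.sum_right, hμ'.sum_right]
  lam_eq i := by
    have e : (fun k => (t • μ + s • μ') k i) = (t • fun k => μ k i) + s • fun k => μ' k i := rfl
    rw [e, rs.lam_add, rs.lam_smul, rs.lam_smul, hμ.lam_eq, hμ'.lam_eq, rs.lam_add, rs.lam_smul,
      rs.lam_smul, h, ← add_smul, hts, one_smul]
    ext r
    simp [Finset.sum_add_distrib, ← Finset.mul_sum]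
    ring

theorem IsNRLaw.exists_lawPayoff_sub_le_lam (hM : rs.IsCompatible M)
    (hα : α ∈ Set.Icc (0 : ℝ) 1) (hp : p ∈ stdSimplex ℝ K) (hp' : p' ∈ stdSimplex ℝ K)
    (h : rs.SameCond p p') (hμ : IsNRLaw rs p μ) :
    ∃ μ', IsNRLaw rs p' μ' ∧ ∀ (c : K → I → ℝ) (φ : (K → ℝ) → ℝ), (∀ k i, |c k i| ≤ 1) →
      ConcLip rs φ → lawPayoff M α c φ μ - lawPayoff M α c φ μ' ≤
        dist1 (rs.lam p) (rs.lam p') := by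
  set a : I → ℝ := fun i => ∑ k, μ k i with ha
  have ha0 : ∀ i, 0 ≤ a i := fun i => Finset.sum_nonneg fun k _ => hμ.nonneg k i
  have ha1 : ∑ i, a i = 1 := hμ.sum_eq_one hp
  set μ' : K → I → ℝ := fun k i => if rs.lam p (rs.cls k) = 0 then p' k * a i else
    rs.lam p' (rs.cls k) / rs.lam p (rs.cls k) * μ k i with hμ'
  have hzero : ∀ k, rs.lam p (rs.cls k) = 0 → ∀ i, μ k i = 0 := fun k hk i =>
    (Finset.sum_eq_zero_iff_of_nonneg fun i _ => hμ.nonneg k i).1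
      ((hμ.sum_right k).trans (rs.eq_zero_of_lam_eq_zero hp.1 hk)) i (Finset.mem_univ i)
  have hnn : ∀ k i, 0 ≤ μ' k i := fun k i => by
    simp only [hμ']
    split_ifs
    · exact mul_nonneg (hp'.1 k) (ha0 i)
    · exact mul_nonneg (div_nonneg (rs.lam_nonneg hp'.1 _) (rs.lam_nonneg hp.1 _)) (hμ.nonneg k i)
  have hlam : ∀ i, rs.lam (fun k => μ' k i) = a i • rs.lam p' := fun i => by
    ext r
    have e : rs.lam (fun k => μ' k i) r = if rs.lam p r = 0 then a i * rs.lam p' r else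
        rs.lam p' r / rs.lam p r * rs.lam (fun k => μ k i) r := by
      split_ifs with h0
      · rw [← rs.lam_mul_cls (fun _ => a i)]
        refine Finset.sum_congr rfl fun k _ => ?_
        split_ifs with hk
        · simp [hμ', hk, h0, mul_comm]
        · rfl
      · rw [← rs.lam_mul_cls (fun r => rs.lam p' r / rs.lam p r)]
        refine Finset.sum_congr rfl fun k _ => ?_
        split_ifs with hk
        · simp [hμ', hk, h0]
        · rfl
    rw [e, hμ.lam_eq]
    split_ifs with h0
    · rfl
    · simp only [Pi.smul_apply, smul_eq_mul, ha]
      field_simp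
  have hsum : ∀ i, ∑ k, μ' k i = a i := fun i => by
    rw [← rs.sum_lam, hlam]
    simp [← Finset.mul_sum, rs.sum_lam, hp'.2]
  have hsame : ∀ i, rs.SameCond (fun k => μ k i) (fun k => μ' k i) := fun i k => by
    rw [hlam, hμ.lam_eq]
    simp only [hμ', Pi.smul_apply, smul_eq_mul]
    split_ifs with h0
    · simp [h0, hzero k h0 i]
    · simp only [ha]
      field_simp
  have hlaw : IsNRLaw rs p' μ' := by
    refine ⟨hnn, fun k => ?_, fun i => by rw [hlam, hsum]⟩
    simp only [hμ']
    split_ifs with h0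
    · rw [← Finset.mul_sum, ha1, mul_one]
    · rw [← Finset.mul_sum, hμ.sum_right, div_mul_eq_mul_div, ← h k, mul_div_cancel_left₀ _ h0]
  refine ⟨μ', hlaw, fun c φ hc hφ => ?_⟩
  have hd : ∀ i, dist1 (rs.lam fun k => μ k i) (rs.lam fun k => μ' k i) =
      a i * dist1 (rs.lam p) (rs.lam p') := fun i => by
    rw [hlam, hμ.lam_eq, dist1_smul (ha0 i)]
  refine lawPayoff_sub_le hα hc (d := fun i => a i * dist1 (rs.lam p) (rs.lam p')) ?_
    (fun i => ?_) fun i => ?_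
  · rw [← Finset.sum_mul, ha1, one_mul]
  · rw [← hd]
    exact (hsame i).dist1_le (fun k => hμ.nonneg k i) fun k => hnn k i
  · rw [← hd]
    exact hφ.persp_sub_le_lam hM (fun k => hμ.nonneg k i) (fun k => hnn k i) (hsum i).symm (hsame i)

theorem IsNRLaw.exists_lawPayoff_sub_le (hM : rs.IsCompatible M)
    (hα : α ∈ Set.Icc (0 : ℝ) 1) (hp : p ∈ stdSimplex ℝ K) (hp' : p' ∈ stdSimplex ℝ K)
    (h : rs.lam p = rs.lam p') {x : K → I → ℝ} (hx : x ∈ NR rs p) :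
    ∃ μ', IsNRLaw rs p' μ' ∧ ∀ (c : K → I → ℝ) (φ : (K → ℝ) → ℝ), (∀ k i, |c k i| ≤ 1) →
      ConcLip rs φ → lawPayoff M α c φ (jointLaw p x) - lawPayoff M α c φ μ' ≤ dist1 p p' := by
  have hμ := isNRLaw_jointLaw hp hx
  set m : K → ℝ := fun k => min (p k) (p' k) with hm
  have hm0 : ∀ k, 0 ≤ m k := fun k => le_min (hp.1 k) (hp'.1 k)
  have hmp : ∀ k, 0 ≤ p k - m k := fun k => sub_nonneg.2 (min_le_left _ _)
  have hmp' : ∀ k, 0 ≤ p' k - m k := fun k => sub_nonneg.2 (min_le_right _ _)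
  set δ : Fin R → ℝ := rs.lam fun k => p k - m k with hδ
  have hlamsub : ∀ u v : K → ℝ, rs.lam (fun k => u k - v k) = rs.lam u - rs.lam v := fun u v => by
    ext r
    simp only [RecStruct.lam, Pi.sub_apply, ← Finset.sum_sub_distrib]
    exact Finset.sum_congr rfl fun k _ => by split_ifs <;> simp
  have hδ' : rs.lam (fun k => p' k - m k) = δ := by rw [hδ, hlamsub, hlamsub, h]
  have hδ0 : ∀ r, 0 ≤ δ r := fun r => rs.lam_nonneg hmp r
  set ρ : Fin R → I → ℝ := fun r i => rs.lam (fun k => (p k - m k) * x k i) r / δ r with hρ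
  have hρ0 : ∀ r i, 0 ≤ ρ r i := fun r i =>
    div_nonneg (rs.lam_nonneg (fun k => mul_nonneg (hmp k) ((hx.1 k).1 i)) r) (hδ0 r)
  have hρδ : ∀ r i, ρ r i * δ r = rs.lam (fun k => (p k - m k) * x k i) r := fun r i => by
    rcases eq_or_ne (δ r) 0 with h0 | h0
    · rw [h0, mul_zero]
      refine (Finset.sum_eq_zero fun k _ => ?_).symm
      split_ifs with hk
      · exact mul_eq_zero_of_left
          (rs.eq_zero_of_lam_eq_zero (k := k) hmp (by rw [hk]; exact h0)) _
      · rfl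
    · exact div_mul_cancel₀ _ h0
  have hρ1 : ∀ r, δ r ≠ 0 → ∑ i, ρ r i = 1 := fun r h0 => by
    rw [← Finset.sum_div, div_eq_one_iff_eq h0]
    simp only [RecStruct.lam, hδ]
    rw [Finset.sum_comm]
    refine Finset.sum_congr rfl fun k _ => ?_
    split_ifs
    · rw [← Finset.mul_sum, (hx.1 k).2, mul_one]
    · simp
  have hρ1' : ∀ k, (p' k - m k) * ∑ i, ρ (rs.cls k) i = p' k - m k := fun k => by
    rcases eq_or_ne (δ (rs.cls k)) 0 with h0 | h0
    · rw [rs.eq_zero_of_lam_eq_zero (k := k) hmp' (by rw [hδ']; exact h0), zero_mul]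
    · rw [hρ1 _ h0, mul_one]
  set μ' : K → I → ℝ := fun k i => m k * x k i + (p' k - m k) * ρ (rs.cls k) i with hμ'
  have hnn : ∀ k i, 0 ≤ μ' k i := fun k i =>
    add_nonneg (mul_nonneg (hm0 k) ((hx.1 k).1 i)) (mul_nonneg (hmp' k) (hρ0 _ i))
  have hlam : ∀ i, rs.lam (fun k => μ' k i) = rs.lam fun k => jointLaw p x k i := fun i => by
    have e₁ : (fun k => μ' k i) =
        (fun k => m k * x k i) + fun k => ρ (rs.cls k) i * (p' k - m k) := by
      ext k
      simp only [hμ', Pi.add_apply]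
      ring
    have e₂ : (fun k => jointLaw p x k i) =
        (fun k => m k * x k i) + fun k => (p k - m k) * x k i := by
      ext k
      simp only [jointLaw, Pi.add_apply]
      ring
    rw [e₁, e₂, rs.lam_add, rs.lam_add]
    congr 1
    ext r
    rw [rs.lam_mul_cls (fun r => ρ r i), hδ', hρδ]
  have hsum : ∀ i, ∑ k, μ' k i = ∑ k, jointLaw p x k i := fun i => by
    rw [← rs.sum_lam, hlam, rs.sum_lam]
  have hlaw : IsNRLaw rs p' μ' := by
    refine ⟨hnn, fun k => ?_, fun i => by rw [hlam, hsum, hμ.lam_eq, h]⟩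
    simp only [hμ', Finset.sum_add_distrib, ← Finset.mul_sum, (hx.1 k).2, hρ1']
    ring
  refine ⟨μ', hlaw, fun c φ hc hφ => ?_⟩
  refine lawPayoff_sub_le hα hc
    (d := fun i => dist1 (fun k => jointLaw p x k i) fun k => μ' k i) ?_ (fun i => le_rfl)
    fun i => hφ.persp_sub_le hM (fun k => hμ.nonneg k i) (fun k => hnn k i) (hsum i).symm
      (hlam i).symm
  simp only [dist1]
  rw [Finset.sum_comm]
  refine Finset.sum_le_sum fun k _ => ?_
  have h₁ : ∀ i, |jointLaw p x k i - μ' k i| ≤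
      (p k - m k) * x k i + (p' k - m k) * ρ (rs.cls k) i := fun i => by
    have := mul_nonneg (hmp k) ((hx.1 k).1 i)
    have := mul_nonneg (hmp' k) (hρ0 (rs.cls k) i)
    simp only [jointLaw, hμ']
    rw [abs_le]
    constructor <;> linarith
  refine (Finset.sum_le_sum fun i _ => h₁ i).trans ?_
  rw [Finset.sum_add_distrib, ← Finset.mul_sum, ← Finset.mul_sum, (hx.1 k).2, hρ1', mul_one]
  rcases le_total (p k) (p' k) with hle | hle
  · simp [hm, min_eq_left hle, abs_of_nonpos (sub_nonpos.2 hle)]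
  · simp [hm, min_eq_right hle, abs_of_nonneg (sub_nonneg.2 hle)]

end Strategies

section Game

variable {K L I J : Type*} [Fintype K] [Fintype L] [Fintype I] [Fintype J] {RK RL : ℕ}

omit [Fintype I] in
theorem pvec_eq_inv_smul (p : K → ℝ) (x : K → I → ℝ) (i : I) :
    pvec p x i = (∑ k, jointLaw p x k i)⁻¹ • fun k => jointLaw p x k i := by
  ext k
  simp [pvec, xOfp, jointLaw, div_eq_inv_mul]

theorem payoff_eq_lawPayoff (M : K → K → ℝ) (N : L → L → ℝ) (g : K → L → I → J → ℝ) (α : ℝ)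
    (f : (K → ℝ) → (L → ℝ) → ℝ) (p : K → ℝ) (q : L → ℝ) (x : K → I → ℝ) (y : L → J → ℝ) :
    payoff M N g α f p q x y = lawPayoff M α (fun k i => ∑ l, ∑ j, q l * y l j * g k l i j)
      (fun p' => ∑ j, xOfp q y j * f p' (vecMulF (pvec q y j) N)) (jointLaw p x) := by
  rw [payoff, lawPayoff, Finset.sum_add_distrib, ← Finset.mul_sum, ← Finset.mul_sum]
  congr 2
  · rw [Gpay, Finset.sum_comm (s := (Finset.univ : Finset I))]
    refine Finset.sum_congr rfl fun k _ => ?_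
    rw [Finset.sum_comm]
    refine Finset.sum_congr rfl fun i _ => ?_
    simp only [Finset.mul_sum, jointLaw]
    exact Finset.sum_congr rfl fun l _ => Finset.sum_congr rfl fun j _ => by ring
  · refine Finset.sum_congr rfl fun i _ => ?_
    rw [persp, ← pvec_eq_inv_smul, Finset.mul_sum]
    exact Finset.sum_congr rfl fun j _ => by simp only [xOfp, jointLaw]; ring

theorem payoff_swap (M : K → K → ℝ) (N : L → L → ℝ) (g : K → L → I → J → ℝ) (α : ℝ)
    (f : (K → ℝ) → (L → ℝ) → ℝ) (p : K → ℝ) (q : L → ℝ) (x : K → I → ℝ) (y : L → J → ℝ) :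
    payoff N M (fun l k j i => -g k l i j) α (fun q p => -f p q) q p y x =
      -payoff M N g α f p q x y := by
  have h₁ : Gpay (fun l k j i => -g k l i j) q p y x = -Gpay g p q x y := by
    simp only [Gpay]
    rw [Finset.sum_comm]
    simp only [← Finset.sum_neg_distrib]
    refine Finset.sum_congr rfl fun k _ => Finset.sum_congr rfl fun l _ => ?_
    rw [Finset.sum_comm]
    exact Finset.sum_congr rfl fun i _ => Finset.sum_congr rfl fun j _ => by ring
  have h₂ : ∑ j, ∑ i, xOfp q y j * xOfp p x i *
        -f (vecMulF (pvec p x i) M) (vecMulF (pvec q y j) N) =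
      -∑ i, ∑ j, xOfp p x i * xOfp q y j *
        f (vecMulF (pvec p x i) M) (vecMulF (pvec q y j) N) := by
    rw [Finset.sum_comm]
    simp only [← Finset.sum_neg_distrib]
    exact Finset.sum_congr rfl fun i _ => Finset.sum_congr rfl fun j _ => by ring
  rw [payoff, payoff, h₁, h₂]
  ring

theorem xOfp_mem {q : L → ℝ} (hq : q ∈ stdSimplex ℝ L) {y : L → J → ℝ}
    (hy : ∀ l, y l ∈ stdSimplex ℝ J) : xOfp q y ∈ stdSimplex ℝ J := by
  refine ⟨fun j => Finset.sum_nonneg fun l _ => mul_nonneg (hq.1 l) ((hy l).1 j), ?_⟩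
  have h : ∀ l, ∑ j, y l j = 1 := fun l => (hy l).2
  change ∑ j, ∑ l, q l * y l j = 1
  rw [Finset.sum_comm]
  simp only [← Finset.mul_sum, h, mul_one, hq.2]

theorem pvec_mem {q : L → ℝ} (hq : q ∈ stdSimplex ℝ L) {y : L → J → ℝ}
    (hy : ∀ l, y l ∈ stdSimplex ℝ J) {j : J} (hj : 0 < xOfp q y j) :
    pvec q y j ∈ stdSimplex ℝ L := by
  rw [pvec_eq_inv_smul]
  exact inv_smul_mem_stdSimplex (fun l => mul_nonneg (hq.1 l) ((hy l).1 j)) hj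

omit [Fintype K] [Fintype I] in
theorem abs_reward_le {g : K → L → I → J → ℝ} (hg : ∀ k l i j, |g k l i j| ≤ 1) {q : L → ℝ}
    (hq : q ∈ stdSimplex ℝ L) {y : L → J → ℝ} (hy : ∀ l, y l ∈ stdSimplex ℝ J) (k : K) (i : I) :
    |∑ l, ∑ j, q l * y l j * g k l i j| ≤ 1 := by
  have h : ∀ l, |∑ j, y l j * g k l i j| ≤ 1 := fun l => by
    simpa [(hy l).2] using abs_sum_mul_le (hy l).1 fun j _ => hg k l i j
  simpa [hq.2, Finset.mul_sum, mul_assoc] using abs_sum_mul_le hq.1 fun l _ => h l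

variable {rsK : RecStruct K RK} {rsL : RecStruct L RL} {M : K → K → ℝ} {N : L → L → ℝ}
  {g : K → L → I → J → ℝ} {α : ℝ} {f : (K → ℝ) → (L → ℝ) → ℝ}

theorem concLip_continuation (hN : rsL.IsCompatible N)
    (hf : ∀ q ∈ stdSimplex ℝ L, ConcLip rsK fun p => f p q) {q : L → ℝ}
    (hq : q ∈ stdSimplex ℝ L) {y : L → J → ℝ} (hy : ∀ l, y l ∈ stdSimplex ℝ J) :
    ConcLip rsK fun p' => ∑ j, xOfp q y j * f p' (vecMulF (pvec q y j) N) :=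
  ConcLip.sum (xOfp_mem hq hy) fun _ hj => hf _ (hN.vecMulF_mem (pvec_mem hq hy hj))

theorem payoff_mem_Icc (hM : rsK.IsCompatible M) (hN : rsL.IsCompatible N)
    (hg : ∀ k l i j, |g k l i j| ≤ 1) (hα : α ∈ Set.Icc (0 : ℝ) 1)
    (hf : ∀ q ∈ stdSimplex ℝ L, ConcLip rsK fun p => f p q)
    {p : K → ℝ} (hp : p ∈ stdSimplex ℝ K) {q : L → ℝ} (hq : q ∈ stdSimplex ℝ L)
    {x : K → I → ℝ} (hx : x ∈ NR rsK p) {y : L → J → ℝ} (hy : y ∈ NR rsL q) :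
    payoff M N g α f p q x y ∈ Set.Icc (-1 : ℝ) 1 := by
  rw [payoff_eq_lawPayoff]
  exact abs_le.1 (abs_lawPayoff_le hM hα (abs_reward_le hg hq hy.1)
    (concLip_continuation hN hf hq hy.1) hp (isNRLaw_jointLaw hp hx))

theorem exists_payoff_sub_le [Nonempty I] (hM : rsK.IsCompatible M) (hN : rsL.IsCompatible N)
    (hg : ∀ k l i j, |g k l i j| ≤ 1) (hα : α ∈ Set.Icc (0 : ℝ) 1)
    (hf : ∀ q ∈ stdSimplex ℝ L, ConcLip rsK fun p => f p q)
    {p : K → ℝ} (hp : p ∈ stdSimplex ℝ K) {p' : K → ℝ} (hp' : p' ∈ stdSimplex ℝ K)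
    (h : rsK.lam p = rsK.lam p') {x : K → I → ℝ} (hx : x ∈ NR rsK p) :
    ∃ x' ∈ NR rsK p', ∀ q ∈ stdSimplex ℝ L, ∀ y ∈ NR rsL q,
      payoff M N g α f p q x y - payoff M N g α f p' q x' y ≤ dist1 p p' := by
  obtain ⟨μ', hμ', hle⟩ := IsNRLaw.exists_lawPayoff_sub_le hM hα hp hp' h hx
  obtain ⟨x', hx', rfl⟩ := hμ'.exists_strategy
  refine ⟨x', hx', fun q hq y hy => ?_⟩
  rw [payoff_eq_lawPayoff, payoff_eq_lawPayoff]
  exact hle _ _ (abs_reward_le hg hq hy.1) (concLip_continuation hN hf hq hy.1)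

theorem exists_payoff_sub_le_lam [Nonempty I] (hM : rsK.IsCompatible M)
    (hN : rsL.IsCompatible N) (hg : ∀ k l i j, |g k l i j| ≤ 1) (hα : α ∈ Set.Icc (0 : ℝ) 1)
    (hf : ∀ q ∈ stdSimplex ℝ L, ConcLip rsK fun p => f p q)
    {p : K → ℝ} (hp : p ∈ stdSimplex ℝ K) {p' : K → ℝ} (hp' : p' ∈ stdSimplex ℝ K)
    (h : rsK.SameCond p p') {x : K → I → ℝ} (hx : x ∈ NR rsK p) :
    ∃ x' ∈ NR rsK p', ∀ q ∈ stdSimplex ℝ L, ∀ y ∈ NR rsL q,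
      payoff M N g α f p q x y - payoff M N g α f p' q x' y ≤
        dist1 (rsK.lam p) (rsK.lam p') := by
  obtain ⟨μ', hμ', hle⟩ :=
    (isNRLaw_jointLaw hp hx).exists_lawPayoff_sub_le_lam hM hα hp hp' h
  obtain ⟨x', hx', rfl⟩ := hμ'.exists_strategy
  refine ⟨x', hx', fun q hq y hy => ?_⟩
  rw [payoff_eq_lawPayoff, payoff_eq_lawPayoff]
  exact hle _ _ (abs_reward_le hg hq hy.1) (concLip_continuation hN hf hq hy.1)

theorem exists_le_payoff_combine [Nonempty I] (hM : rsK.IsCompatible M)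
    (hN : rsL.IsCompatible N) (hα : α ∈ Set.Icc (0 : ℝ) 1)
    (hf : ∀ q ∈ stdSimplex ℝ L, ConcLip rsK fun p => f p q)
    {p : K → ℝ} (hp : p ∈ stdSimplex ℝ K) {p' : K → ℝ} (hp' : p' ∈ stdSimplex ℝ K)
    (h : rsK.lam p = rsK.lam p') {t s : ℝ} (ht : 0 ≤ t) (hs : 0 ≤ s) (hts : t + s = 1)
    {x : K → I → ℝ} (hx : x ∈ NR rsK p) {x' : K → I → ℝ} (hx' : x' ∈ NR rsK p') :
    ∃ z ∈ NR rsK (t • p + s • p'), ∀ q ∈ stdSimplex ℝ L, ∀ y ∈ NR rsL q,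
      t * payoff M N g α f p q x y + s * payoff M N g α f p' q x' y ≤
        payoff M N g α f (t • p + s • p') q z y := by
  have hμ := isNRLaw_jointLaw hp hx
  have hμ' := isNRLaw_jointLaw hp' hx'
  obtain ⟨z, hz, hzμ⟩ := (hμ.combine hμ' h ht hs hts).exists_strategy
  refine ⟨z, hz, fun q hq y hy => ?_⟩
  rw [payoff_eq_lawPayoff, payoff_eq_lawPayoff, payoff_eq_lawPayoff, hzμ]
  exact le_lawPayoff_combine hM hα (concLip_continuation hN hf hq hy.1) hμ hμ' h ht hs

theorem concLip_Phi_left [Nonempty I] [Nonempty J] (hM : rsK.IsCompatible M)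
    (hN : rsL.IsCompatible N) (hg : ∀ k l i j, |g k l i j| ≤ 1) (hα : α ∈ Set.Icc (0 : ℝ) 1)
    (hf : ∀ q ∈ stdSimplex ℝ L, ConcLip rsK fun p => f p q)
    {q : L → ℝ} (hq : q ∈ stdSimplex ℝ L) :
    ConcLip rsK fun p => Phi rsK rsL M N g α f p q := by
  have hH : ∀ p ∈ stdSimplex ℝ K, ∀ x ∈ (NR rsK p : Set (K → I → ℝ)),
      ∀ y ∈ (NR rsL q : Set (L → J → ℝ)), payoff M N g α f p q x y ∈ Set.Icc (-1 : ℝ) 1 :=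
    fun p hp x hx y hy => payoff_mem_Icc hM hN hg hα hf hp hq hx hy
  have hY : (NR rsL q : Set (L → J → ℝ)).Nonempty := nr_nonempty rsL hq
  have hlip : ∀ p ∈ stdSimplex ℝ K, ∀ p' ∈ stdSimplex ℝ K, ∀ D : ℝ,
      (∀ x ∈ (NR rsK p : Set (K → I → ℝ)), ∃ x' ∈ (NR rsK p' : Set (K → I → ℝ)),
        ∀ q ∈ stdSimplex ℝ L, ∀ y ∈ (NR rsL q : Set (L → J → ℝ)),
          payoff M N g α f p q x y - payoff M N g α f p' q x' y ≤ D) →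
      Phi rsK rsL M N g α f p q - Phi rsK rsL M N g α f p' q ≤ D := fun p hp p' hp' D h => by
    have := lowerValue_combine_left (D := D) hY (nr_nonempty rsK hp) (nr_nonempty rsK hp)
      (hH p' hp') (hH p hp) (hH p hp) zero_le_one le_rfl fun x hx _ _ =>
        let ⟨x', hx', hle⟩ := h x hx
        ⟨x', hx', fun y hy => by linarith [hle q hq y hy]⟩
    rw [one_mul, zero_mul, add_zero] at this
    exact sub_le_iff_le_add'.2 this
  refine ⟨fun p hp => abs_le.2 (lowerValue_mem_Icc (nr_nonempty rsK hp) hY (hH p hp)),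
    fun p hp p' hp' h => hlip p hp p' hp' _ fun x hx =>
      exists_payoff_sub_le hM hN hg hα hf hp hp' h hx,
    fun p hp p' hp' h => hlip p hp p' hp' _ fun x hx =>
      exists_payoff_sub_le_lam hM hN hg hα hf hp hp' h hx,
    fun p hp p' hp' h t s ht hs hts => ?_⟩
  have := lowerValue_combine_left (D := 0) hY (nr_nonempty rsK hp) (nr_nonempty rsK hp')
    (hH _ (convex_stdSimplex ℝ K hp hp' ht hs hts)) (hH p hp) (hH p' hp') ht hs
    fun x hx x' hx' =>
      let ⟨z, hz, hle⟩ := exists_le_payoff_combine (g := g) hM hN hα hf hp hp' h ht hs hts hx hx'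
      ⟨z, hz, fun y hy => by linarith [hle q hq y hy]⟩
  rwa [add_zero] at this

theorem concLip_neg_Phi_right [Nonempty I] [Nonempty J] (hM : rsK.IsCompatible M)
    (hN : rsL.IsCompatible N) (hg : ∀ k l i j, |g k l i j| ≤ 1) (hα : α ∈ Set.Icc (0 : ℝ) 1)
    (hf : ∀ p ∈ stdSimplex ℝ K, ConcLip rsL fun q => -f p q)
    {p : K → ℝ} (hp : p ∈ stdSimplex ℝ K) :
    ConcLip rsL fun q => -Phi rsK rsL M N g α f p q := by
  have hg' : ∀ l k j i, |-g k l i j| ≤ 1 := fun l k j i => by rw [abs_neg]; exact hg k l i j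
  have hH : ∀ q ∈ stdSimplex ℝ L, ∀ x ∈ (NR rsK p : Set (K → I → ℝ)),
      ∀ y ∈ (NR rsL q : Set (L → J → ℝ)), payoff M N g α f p q x y ∈ Set.Icc (-1 : ℝ) 1 :=
    fun q hq x hx y hy => by
      have := payoff_mem_Icc hN hM hg' hα hf hq hp hy hx
      rw [payoff_swap] at this
      exact ⟨by linarith [this.2], by linarith [this.1]⟩
  have hX : (NR rsK p : Set (K → I → ℝ)).Nonempty := nr_nonempty rsK hp
  have hlip : ∀ q ∈ stdSimplex ℝ L, ∀ q' ∈ stdSimplex ℝ L, ∀ D : ℝ,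
      (∀ y ∈ (NR rsL q : Set (L → J → ℝ)), ∃ y' ∈ (NR rsL q' : Set (L → J → ℝ)),
        ∀ p ∈ stdSimplex ℝ K, ∀ x ∈ (NR rsK p : Set (K → I → ℝ)),
          payoff N M (fun l k j i => -g k l i j) α (fun q p => -f p q) q p y x -
            payoff N M (fun l k j i => -g k l i j) α (fun q p => -f p q) q' p y' x ≤ D) →
      -Phi rsK rsL M N g α f p q - -Phi rsK rsL M N g α f p q' ≤ D := fun q hq q' hq' D h => by
    have : Phi rsK rsL M N g α f p q' ≤ _ :=
      lowerValue_combine_right (D := D) hX (nr_nonempty rsL hq) (nr_nonempty rsL hq)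
      (hH q' hq') (hH q hq) (hH q hq) zero_le_one le_rfl fun y hy _ _ =>
        let ⟨y', hy', hle⟩ := h y hy
        ⟨y', hy', fun x hx => by
          have := hle p hp x hx
          rw [payoff_swap, payoff_swap] at this
          linarith⟩
    rw [one_mul, zero_mul, add_zero] at this
    change _ ≤ Phi rsK rsL M N g α f p q + D at this
    linarith
  refine ⟨fun q hq => ?_,
    fun q hq q' hq' h => hlip q hq q' hq' _ fun y hy =>
      exists_payoff_sub_le hN hM hg' hα hf hq hq' h hy,
    fun q hq q' hq' h => hlip q hq q' hq' _ fun y hy =>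
      exists_payoff_sub_le_lam hN hM hg' hα hf hq hq' h hy,
    fun q hq q' hq' h t s ht hs hts => ?_⟩
  · rw [abs_neg]
    exact abs_le.2 (lowerValue_mem_Icc hX (nr_nonempty rsL hq) (hH q hq))
  · have : Phi rsK rsL M N g α f p (t • q + s • q') ≤ _ :=
      lowerValue_combine_right (D := 0) hX (nr_nonempty rsL hq) (nr_nonempty rsL hq')
      (hH _ (convex_stdSimplex ℝ L hq hq' ht hs hts)) (hH q hq) (hH q' hq') ht hs
      fun y hy y' hy' =>
        let ⟨z, hz, hle⟩ :=
          exists_le_payoff_combine (g := fun l k j i => -g k l i j) hN hM hα hf hq hq' h ht hs hts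
            hy hy'
        ⟨z, hz, fun x hx => by
          have := hle p hp x hx
          rw [payoff_swap, payoff_swap, payoff_swap] at this
          linarith⟩
    change _ ≤ t * Phi rsK rsL M N g α f p q + s * Phi rsK rsL M N g α f p q' + 0 at this
    linarith

end Game

section Conclusion

variable {K : Type*} [Fintype K] {R : ℕ}

theorem concLip_zero (rs : RecStruct K R) : ConcLip rs fun _ => 0 where
  abs_le := by simp
  lip p _ p' _ _ := by simpa using dist1_nonneg p p'
  lip_lam p _ p' _ _ := by simpa using dist1_nonneg (rs.lam p) (rs.lam p')
  conc := by simp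

/-- `Sdist` splits along an intermediate law with the conditionals of `p` and the class masses
of `p'`. -/
theorem RecStruct.exists_intermediate (rs : RecStruct K R) {p p' : K → ℝ}
    (hp : p ∈ stdSimplex ℝ K) (hp' : p' ∈ stdSimplex ℝ K) :
    ∃ w ∈ stdSimplex ℝ K, rs.SameCond p w ∧ rs.lam w = rs.lam p' ∧
      rs.Sdist p p' = dist1 (rs.lam p) (rs.lam p') + dist1 w p' := by
  set w : K → ℝ := fun k => if rs.lam p (rs.cls k) = 0 then p' k else
    rs.lam p' (rs.cls k) / rs.lam p (rs.cls k) * p k with hw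
  have hlam : rs.lam w = rs.lam p' := by
    ext r
    have e : rs.lam w r = if rs.lam p r = 0 then rs.lam p' r else
        rs.lam p' r / rs.lam p r * rs.lam p r := by
      split_ifs with h0
      · refine Finset.sum_congr rfl fun k _ => ?_
        split_ifs with hk
        · simp [hw, hk, h0]
        · rfl
      · rw [← rs.lam_mul_cls (fun r => rs.lam p' r / rs.lam p r)]
        refine Finset.sum_congr rfl fun k _ => ?_
        split_ifs with hk
        · simp [hw, hk, h0]
        · rfl
    rw [e]
    split_ifs with h0
    · rfl
    · exact div_mul_cancel₀ _ h0
  refine ⟨w, ⟨fun k => ?_, by rw [← rs.sum_lam, hlam, rs.sum_lam, hp'.2]⟩, fun k => ?_, hlam, ?_⟩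
  · simp only [hw]
    split_ifs
    · exact hp'.1 k
    · exact mul_nonneg (div_nonneg (rs.lam_nonneg hp'.1 _) (rs.lam_nonneg hp.1 _)) (hp.1 k)
  · rw [hlam]
    simp only [hw]
    split_ifs with h0
    · simp [h0, rs.eq_zero_of_lam_eq_zero hp.1 h0]
    · field_simp
  · rw [RecStruct.Sdist, dist1, dist1, ← rs.sum_lam]
    congr 1
    refine Finset.sum_congr rfl fun r _ => ?_
    have hn := rs.lam_nonneg hp.1 r
    have hn' := rs.lam_nonneg hp'.1 r
    rcases hn.eq_or_lt with h0 | h0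
    · rw [← h0, zero_mul, if_neg (lt_irrefl _)]
      refine (Finset.sum_eq_zero fun k _ => ?_).symm
      split_ifs with hk
      · simp [hw, hk, ← h0]
      · rfl
    rcases hn'.eq_or_lt with h1 | h1
    · rw [← h1, mul_zero, if_neg (lt_irrefl _)]
      refine (Finset.sum_eq_zero fun k _ => ?_).symm
      split_ifs with hk
      · have : p' k = 0 := rs.eq_zero_of_lam_eq_zero hp'.1 (by rw [hk, h1])
        simp [hw, hk, ← h1, this]
      · rfl
    · rw [if_pos (mul_pos h0 h1), RecStruct.cond, RecStruct.cond, if_pos h0, if_pos h1, dist1,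
        Finset.mul_sum]
      refine Finset.sum_congr rfl fun k _ => ?_
      by_cases hk : rs.cls k = r
      · simp only [hk, if_true, hw, h0.ne', if_false]
        nth_rewrite 1 [← abs_of_pos h1]
        rw [← abs_mul]
        congr 1
        field_simp
      · simp [hk]

namespace ConcLip

variable {rs : RecStruct K R} {φ : (K → ℝ) → ℝ}

theorem sub_le_Sdist (hφ : ConcLip rs φ) {p p' : K → ℝ} (hp : p ∈ stdSimplex ℝ K)
    (hp' : p' ∈ stdSimplex ℝ K) : φ p - φ p' ≤ rs.Sdist p p' := by
  obtain ⟨w, hw, hpw, hlam, hS⟩ := rs.exists_intermediate hp hp'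
  have h₁ := hφ.lip_lam p hp w hw hpw
  have h₂ := hφ.lip w hw p' hp' hlam
  rw [hlam] at h₁
  linarith

theorem concaveOn_Binv (hφ : ConcLip rs φ) (pst : K → ℝ) : ConcaveOn ℝ (rs.Binv pst) φ := by
  refine ⟨fun p hp p' hp' t s ht hs hts => ⟨convex_stdSimplex ℝ K hp.1 hp'.1 ht hs hts, ?_⟩,
    fun p hp p' hp' t s ht hs hts => ?_⟩
  · rw [vecMulF_add, vecMulF_smul, vecMulF_smul, hp.2, hp'.2, ← add_smul, hts, one_smul]
  · refine hφ.conc p hp.1 p' hp'.1 ?_ t s ht hs hts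
    rw [← rs.lam_vecMulF_Bmat p, hp.2, ← hp'.2, rs.lam_vecMulF_Bmat]

end ConcLip

theorem RecStruct.Sdist_le (rs : RecStruct K R) {p p' : K → ℝ} (hp : p ∈ stdSimplex ℝ K)
    (hp' : p' ∈ stdSimplex ℝ K) : rs.Sdist p p' ≤ 3 * dist1 p p' := by
  obtain ⟨w, hw, hpw, hlam, hS⟩ := rs.exists_intermediate hp hp'
  have h₁ := hpw.dist1_le hp.1 hw.1
  have h₂ := rs.dist1_lam_le p p'
  have h₃ := dist1_triangle w p p'
  rw [dist1_comm w p] at h₃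
  rw [hlam] at h₁
  linarith

variable {L : Type*} [Fintype L] {RL : ℕ} {rsK : RecStruct K R} {rsL : RecStruct L RL}
  {f : (K → ℝ) → (L → ℝ) → ℝ}

theorem memF_of_concLip (hK : ∀ q ∈ stdSimplex ℝ L, ConcLip rsK fun p => f p q)
    (hL : ∀ p ∈ stdSimplex ℝ K, ConcLip rsL fun q => -f p q) : MemF rsK rsL f where
  mem_Icc p hp q hq := abs_le.1 ((hK q hq).abs_le p hp)
  lipK p hp p' hp' q hq := (hK q hq).sub_le_Sdist hp hp'
  lipL p hp q hq q' hq' := by linarith [(hL p hp).sub_le_Sdist hq' hq]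
  concaveI pst _ q hq := (hK q hq).concaveOn_Binv pst
  convexII qst _ p hp := by
    have := ((hL p hp).concaveOn_Binv qst).neg
    simpa [Pi.neg_def] using this

theorem MemF.abs_sub_le (hf : MemF rsK rsL f) {p p' : K → ℝ} (hp : p ∈ stdSimplex ℝ K)
    (hp' : p' ∈ stdSimplex ℝ K) {q q' : L → ℝ} (hq : q ∈ stdSimplex ℝ L)
    (hq' : q' ∈ stdSimplex ℝ L) : |f p q - f p' q'| ≤ 3 * (dist1 p p' + dist1 q q') := by
  have h₁ := rsK.Sdist_le hp hp'
  have h₂ := rsK.Sdist_le hp' hp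
  have h₃ := rsL.Sdist_le hq hq'
  have h₄ := rsL.Sdist_le hq' hq
  rw [dist1_comm p' p] at h₂
  rw [dist1_comm q' q] at h₄
  rw [abs_le]
  constructor <;>
    linarith [hf.lipK p hp p' hp' q hq, hf.lipK p' hp' p hp q hq, hf.lipL p' hp' q hq q' hq',
      hf.lipL p' hp' q' hq' q hq]

end Conclusion

/-- **Regularity of the nonrevealing values (Proposition `vhatequicontinu`).**
With `v̂_0 = 0` and `v̂_{T+1} = Φ_{1/(T+1)}(v̂_T)`, every `v̂_T` with `T ≥ 1` belongs to the
class `F`; in particular it is `3`-Lipschitz on `Δ(K)×Δ(L)` for the `L¹` norms. -/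
theorem vhat_memF_and_lipschitz {K L I J : Type*}
    [Fintype K] [Nonempty K] [Fintype L] [Nonempty L]
    [Fintype I] [Nonempty I] [Fintype J] [Nonempty J] {RK RL : ℕ}
    (rsK : RecStruct K RK) (rsL : RecStruct L RL)
    (M : K → K → ℝ) (N : L → L → ℝ)
    (hM : rsK.IsCompatible M) (hN : rsL.IsCompatible N)
    (g : K → L → I → J → ℝ) (hg : ∀ k l i j, g k l i j ∈ Set.Icc (-1 : ℝ) 1)
    (vhat : ℕ → (K → ℝ) → (L → ℝ) → ℝ)
    (h0 : vhat 0 = fun _ _ => 0)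
    (hrec : ∀ T : ℕ, vhat (T + 1) = Phi rsK rsL M N g (1 / ((T : ℝ) + 1)) (vhat T)) :
    ∀ T : ℕ, 1 ≤ T → MemF rsK rsL (vhat T) ∧
      ∀ p ∈ stdSimplex ℝ K, ∀ p' ∈ stdSimplex ℝ K,
      ∀ q ∈ stdSimplex ℝ L, ∀ q' ∈ stdSimplex ℝ L,
        |vhat T p q - vhat T p' q'| ≤ 3 * (dist1 p p' + dist1 q q') := by
  have hg' : ∀ k l i j, |g k l i j| ≤ 1 := fun k l i j => abs_le.2 (hg k l i j)
  have key : ∀ T, (∀ q ∈ stdSimplex ℝ L, ConcLip rsK fun p => vhat T p q) ∧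
      ∀ p ∈ stdSimplex ℝ K, ConcLip rsL fun q => -vhat T p q := fun T => by
    induction T with
    | zero =>
      simp only [h0, neg_zero]
      exact ⟨fun _ _ => concLip_zero rsK, fun _ _ => concLip_zero rsL⟩
    | succ T ih =>
      have hα : 1 / ((T : ℝ) + 1) ∈ Set.Icc (0 : ℝ) 1 :=
        ⟨by positivity, div_le_one_of_le₀ (by linarith [T.cast_nonneg (α := ℝ)]) (by positivity)⟩
      rw [hrec]
      exact ⟨fun q hq => concLip_Phi_left hM hN hg' hα ih.1 hq,
        fun p hp => concLip_neg_Phi_right hM hN hg' hα ih.2 hp⟩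
  intro T _
  have hF := memF_of_concLip (key T).1 (key T).2
  exact ⟨hF, fun p hp p' hp' q hq q' hq' => hF.abs_sub_le hp hp' hq hq'⟩
end
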